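/- arXiv:1107.0778 — 9 statements merged into one kernel-verified Lean document; each statement's English description precedes it below -/
import Mathlib

section
/- Let 𝒞 be a finitely complete category. Then the following two conditions are equivalent: (i) 𝒞 has a strict initial object, and for every pair of monomorphisms a : A ↪ C and b : B ↪ C with pullback (intersection) A ∩ B, the pushout A +_{A∩B} B of the span A ↩ A∩B ↪ B exists and this pushout is stable under pullback; (ii) 𝒞 admits finite unions of subobjects (a least subobject of every object and binary joins of subobjects) which are stable under pullback and effective, i.e. for any two subobjects A, B of an object C the commutative square with vertices A∩B, A, B, A∪B (given by the intersection inclusions into A and B and the inclusions of A and B into A∪B) is a pushout square. -/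
open CategoryTheory CategoryTheory.Limits

universe v u

namespace CategoryTheory

variable {C : Type u} [Category.{v} C]

section Universal

variable {W X Y Z : C} {f : W ⟶ X} {g : W ⟶ Y} {h : X ⟶ Z} {i : Y ⟶ Z}

/-- A convenient formulation for a pushout being a universal colimit: any commutative cube over
the pushout square whose back and front faces are pullbacks has a pushout as its top face. -/
def IsPushout.IsUniversal (_ : IsPushout f g h i) : Prop :=
  ∀ ⦃W' X' Y' Z' : C⦄ (f' : W' ⟶ X') (g' : W' ⟶ Y') (h' : X' ⟶ Z') (i' : Y' ⟶ Z') (αW : W' ⟶ W)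
    (αX : X' ⟶ X) (αY : Y' ⟶ Y) (αZ : Z' ⟶ Z) (_ : IsPullback f' αW αX f)
    (_ : IsPullback g' αW αY g) (_ : IsPullback h' αX αZ h) (_ : IsPullback i' αY αZ i)
    (_ : CommSq f' g' h' i'), IsPushout f' g' h' i'

theorem IsPushout.isUniversal_iff (H : IsPushout f g h i) :
    H.IsUniversal ↔ IsUniversalColimit (PushoutCocone.mk h i H.w) := by
  constructor
  · intro H F' c' α φ eα hα hc
    have w : F'.map WalkingSpan.Hom.fst ≫ c'.ι.app WalkingSpan.left =
        F'.map WalkingSpan.Hom.snd ≫ c'.ι.app WalkingSpan.right := by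
      simp only [Cocone.w]
    have key := H (F'.map WalkingSpan.Hom.fst) (F'.map WalkingSpan.Hom.snd) (c'.ι.app _)
      (c'.ι.app _) (α.app _) (α.app _) (α.app _) φ (by convert! hα WalkingSpan.Hom.fst)
      (by convert! hα WalkingSpan.Hom.snd) (hc WalkingSpan.left) (hc WalkingSpan.right) ⟨w⟩
    refine ⟨{
      desc s := key.desc (s.ι.app WalkingSpan.left) (s.ι.app WalkingSpan.right)
        (by simp only [Cocone.w])
      fac s := ?_
      uniq s m hm := ?_ }⟩
    · rintro (_ | _ | _)
      · exact (c'.w_assoc WalkingSpan.Hom.fst _).symm.trans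
          ((congrArg _ (key.inl_desc _ _ _)).trans (s.w WalkingSpan.Hom.fst))
      exacts [key.inl_desc _ _ _, key.inr_desc _ _ _]
    · exact key.hom_ext ((hm _).trans (key.inl_desc _ _ _).symm)
        ((hm _).trans (key.inr_desc _ _ _).symm)
  · introv H W' hf hg hh hi w
    refine ⟨w, H w.cocone ⟨by rintro (_ | _ | _); exacts [αW, αX, αY], ?_⟩ αZ ?_ ?_ ?_⟩
    · rintro i _ (_ | _ | _)
      · dsimp; simp only [Functor.map_id, Category.comp_id, Category.id_comp]
      exacts [hf.w, hg.w]
    · ext (_ | _ | _)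
      · change αW ≫ f ≫ h = (f' ≫ h') ≫ αZ
        rw [Category.assoc, hh.w, hf.w_assoc]
      exacts [hh.w.symm, hi.w.symm]
    · rintro i _ (_ | _ | _)
      · dsimp; simp_rw [Functor.map_id]
        exact IsPullback.of_horiz_isIso ⟨by rw [Category.comp_id, Category.id_comp]⟩
      exacts [hf, hg]
    · rintro (_ | _ | _)
      · dsimp; rw [PushoutCocone.condition_zero]; exact hf.paste_horiz hh
      exacts [hh, hi]

/-- If every generalized element of `Z'` lying over one of the two legs of a universal pushout
factors through a monomorphism `m`, then `m` has a section. -/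
theorem IsPushout.IsUniversal.exists_section [HasPullbacks C] {H : IsPushout f g h i}
    (H' : H.IsUniversal) {Z' V : C} (αZ : Z' ⟶ Z) (m : V ⟶ Z') [Mono m]
    (hX : ∀ ⦃T : C⦄ (w : T ⟶ Z') (x : T ⟶ X), w ≫ αZ = x ≫ h → ∃ l, l ≫ m = w)
    (hY : ∀ ⦃T : C⦄ (w : T ⟶ Z') (y : T ⟶ Y), w ≫ αZ = y ≫ i → ∃ l, l ≫ m = w) :
    ∃ s : Z' ⟶ V, s ≫ m = 𝟙 Z' := by
  have hh := IsPullback.of_hasPullback αZ h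
  have hi := IsPullback.of_hasPullback αZ i
  have hf := IsPullback.of_hasPullback (pullback.snd αZ h) f
  let g' : pullback (pullback.snd αZ h) f ⟶ pullback αZ i :=
    pullback.lift (pullback.fst _ _ ≫ pullback.fst _ _) (pullback.snd _ _ ≫ g)
      (by simp only [Category.assoc, pullback.condition, pullback.condition_assoc, H.w])
  have hg : IsPullback g' (pullback.snd _ _) (pullback.snd αZ i) g := by
    refine IsPullback.of_right ?_ (pullback.lift_snd _ _ _) hi
    have e : g' ≫ pullback.fst αZ i = pullback.fst _ _ ≫ pullback.fst αZ h :=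
      pullback.lift_fst _ _ _
    rw [e, ← H.w]
    exact hf.paste_horiz hh
  have P := H' _ g' _ _ _ _ _ αZ hf hg hh hi ⟨(pullback.lift_fst _ _ _).symm⟩
  obtain ⟨l, hl⟩ := hX _ _ hh.w
  obtain ⟨r, hr⟩ := hY _ _ hi.w
  refine ⟨P.desc l r ?_, ?_⟩
  · rw [← cancel_mono m, Category.assoc, Category.assoc, hl, hr, P.w]
  · apply P.hom_ext <;> simp [hl, hr]

theorem IsPushout.IsUniversal.hom_ext [HasPullbacks C] [HasEqualizers C] {H : IsPushout f g h i}
    (H' : H.IsUniversal) {Z' T : C} (αZ : Z' ⟶ Z) {p q : Z' ⟶ T}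
    (hX : ∀ ⦃S : C⦄ (w : S ⟶ Z') (x : S ⟶ X), w ≫ αZ = x ≫ h → w ≫ p = w ≫ q)
    (hY : ∀ ⦃S : C⦄ (w : S ⟶ Z') (y : S ⟶ Y), w ≫ αZ = y ≫ i → w ≫ p = w ≫ q) : p = q := by
  obtain ⟨s, hs⟩ := H'.exists_section αZ (equalizer.ι p q)
    (fun _ w x e ↦ ⟨equalizer.lift w (hX w x e), equalizer.lift_ι _ _⟩)
    (fun _ w y e ↦ ⟨equalizer.lift w (hY w y e), equalizer.lift_ι _ _⟩)
  rw [← Category.id_comp p, ← Category.id_comp q, ← hs, Category.assoc, equalizer.condition,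
    Category.assoc]

/-- The map out of a universal pushout of an intersection of two subobjects is a monomorphism. -/
theorem IsPushout.IsUniversal.mono_of_isPullback [HasPullbacks C] [HasEqualizers C]
    {H : IsPushout f g h i} (H' : H.IsUniversal) {B : C} {a : X ⟶ B} {b : Y ⟶ B} [Mono a] [Mono b]
    (hab : IsPullback f g a b) {k : Z ⟶ B} (ha : h ≫ k = a) (hb : i ≫ k = b) : Mono k := by
  have glue : ∀ ⦃T : C⦄ (x : T ⟶ X) (y : T ⟶ Y), x ≫ a = y ≫ b → x ≫ h = y ≫ i := by
    intro T x y e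
    rw [← hab.lift_fst x y e, Category.assoc, H.w, ← Category.assoc, hab.lift_snd]
  refine ⟨fun p q e ↦ H'.hom_ext p (fun S w x hw ↦ ?_) (fun S w y hw ↦ ?_)⟩
  · refine H'.hom_ext (w ≫ q) (fun S' w' x' hw' ↦ ?_) (fun S' w' y' hw' ↦ ?_)
    · rw [hw', hw, ← Category.assoc]
      congr 1
      rw [← cancel_mono a, ← ha, Category.assoc, ← reassoc_of% hw, e,
        ← reassoc_of% hw']
    · rw [hw', hw, ← Category.assoc]
      refine glue _ _ ?_
      rw [← ha, ← hb, Category.assoc, ← reassoc_of% hw, e, ← reassoc_of% hw']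
  · refine H'.hom_ext (w ≫ q) (fun S' w' x' hw' ↦ ?_) (fun S' w' y' hw' ↦ ?_)
    · rw [hw', hw, ← Category.assoc]
      refine (glue _ _ ?_).symm
      rw [← ha, ← hb, Category.assoc, ← reassoc_of% hw, e, ← reassoc_of% hw']
    · rw [hw', hw, ← Category.assoc]
      congr 1
      rw [← cancel_mono b, ← hb, Category.assoc, ← reassoc_of% hw, e,
        ← reassoc_of% hw']

/-- The subobject represented by a universal pushout is a pullback-stable join. -/
theorem IsPushout.IsUniversal.pullback_mk_le [HasPullbacks C] {H : IsPushout f g h i}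
    (H' : H.IsUniversal) {B B' : C} (k : Z ⟶ B) [Mono k] {S T : Subobject B}
    (hS : S.Factors (h ≫ k)) (hT : T.Factors (i ≫ k)) (φ : B' ⟶ B) {V : Subobject B'}
    (hSV : (Subobject.pullback φ).obj S ≤ V) (hTV : (Subobject.pullback φ).obj T ≤ V) :
    (Subobject.pullback φ).obj (Subobject.mk k) ≤ V := by
  set P := (Subobject.pullback φ).obj (Subobject.mk k)
  let α : (P : C) ⟶ Z := Subobject.pullbackπ φ (Subobject.mk k) ≫ (Subobject.underlyingIso k).hom
  have hα : α ≫ k = P.arrow ≫ φ := by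
    simp only [α, P, Category.assoc, Subobject.underlyingIso_hom_comp_eq_mk]
    exact (Subobject.isPullback φ (Subobject.mk k)).w
  have key : ∀ {R : Subobject B} {A : C} {j : A ⟶ Z}, R.Factors (j ≫ k) →
      (Subobject.pullback φ).obj R ≤ V → ∀ ⦃Q : C⦄ (w : Q ⟶ P) (x : Q ⟶ A), w ≫ α = x ≫ j →
        ∃ l, l ≫ pullback.fst P.arrow V.arrow = w := by
    intro R A j hR hRV Q w x e
    refine ⟨pullback.lift w ((Subobject.isPullback φ R).lift (x ≫ R.factorThru _ hR)
      (w ≫ P.arrow) ?_ ≫ Subobject.ofLE _ _ hRV) ?_, pullback.lift_fst _ _ _⟩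
    · simp [← hα, reassoc_of% e]
    · simp
  obtain ⟨s, hs⟩ := H'.exists_section α (pullback.fst P.arrow V.arrow) (key hS hSV) (key hT hTV)
  refine Subobject.le_of_comm (s ≫ pullback.snd _ _) ?_
  rw [Category.assoc, ← pullback.condition, reassoc_of% hs]

end Universal

theorem Subobject.isPushout_of_isPullback [HasPullbacks C] {P A B X : C} {a : A ⟶ X} {b : B ⟶ X}
    [Mono a] [Mono b] {p : P ⟶ A} {q : P ⟶ B} (hp : IsPullback p q a b) {U : Subobject X}
    (ha : Subobject.mk a ≤ U) (hb : Subobject.mk b ≤ U)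
    (H : IsPushout (Subobject.ofLE (Subobject.mk a ⊓ Subobject.mk b) _ _root_.inf_le_left)
      (Subobject.ofLE (Subobject.mk a ⊓ Subobject.mk b) _ _root_.inf_le_right)
      (Subobject.ofLE _ U ha) (Subobject.ofLE _ U hb)) :
    IsPushout p q (Subobject.ofMkLE a U ha) (Subobject.ofMkLE b U hb) := by
  have hI : IsPullback
      (Subobject.ofLE (Subobject.mk a ⊓ Subobject.mk b) _ _root_.inf_le_left ≫
        (Subobject.underlyingIso a).hom)
      (Subobject.ofLE (Subobject.mk a ⊓ Subobject.mk b) _ _root_.inf_le_right ≫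
        (Subobject.underlyingIso b).hom) a b :=
    (Subobject.inf_isPullback (Subobject.mk a) (Subobject.mk b)).of_iso (Iso.refl _)
      (Subobject.underlyingIso a) (Subobject.underlyingIso b) (Iso.refl _)
      (by simp) (by simp) (by simp) (by simp)
  refine H.of_iso (IsPullback.isoIsPullback _ _ hI hp) (Subobject.underlyingIso a)
    (Subobject.underlyingIso b) (Iso.refl _) (by simp) (by simp) ?_ ?_
  · simp [← cancel_mono U.arrow]
  · simp [← cancel_mono U.arrow]

section Initial

variable [HasFiniteLimits C]

theorem Subobject.pullback_arrow_self {X : C} (S : Subobject X) :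
    (Subobject.pullback S.arrow).obj S = ⊤ := by
  simpa only [Subobject.mk_arrow] using Subobject.pullback_self S.arrow

theorem Subobject.eq_top_of_forall_pullback_le {Z : Subobject (⊤_ C)}
    (hZ : ∀ {Y : C} (f : Y ⟶ ⊤_ C) (S : Subobject Y), (Subobject.pullback f).obj Z ≤ S)
    {W : C} (w : W ⟶ Z) (S : Subobject W) : S = ⊤ := by
  rw [eq_top_iff]
  simpa only [Subobject.pullback_comp, Subobject.pullback_arrow_self, Subobject.pullback_top]
    using hZ (w ≫ Z.arrow) S

/-- A pullback-stable least subobject of the terminal object is a strict initial object. -/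
theorem hasStrictInitialObjects_of_forall_pullback_le {Z : Subobject (⊤_ C)}
    (hZ : ∀ {Y : C} (f : Y ⟶ ⊤_ C) (S : Subobject Y), (Subobject.pullback f).obj Z ≤ S) :
    HasInitial C ∧ HasStrictInitialObjects C := by
  have top : ∀ {W : C} (_ : W ⟶ Z) (S : Subobject W), S = ⊤ :=
    Subobject.eq_top_of_forall_pullback_le hZ
  have ext : ∀ {W Y : C} (_ : W ⟶ Z) (p q : W ⟶ Y), p = q := by
    intro W Y w p q
    have : IsIso (equalizer.ι p q) := by
      rw [Subobject.isIso_iff_mk_eq_top]; exact top w _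
    exact eq_of_epi_equalizer
  have iso : ∀ {W : C} (w : W ⟶ Z), IsIso w := by
    intro W w
    have : Mono w := ⟨fun p q _ ↦ ext (p ≫ w) p q⟩
    rw [Subobject.isIso_iff_mk_eq_top]
    exact top (𝟙 _) _
  have hI : IsInitial (Z : C) := by
    refine IsInitial.ofUniqueHom (fun Y ↦ ?_) (fun Y m ↦ ext (𝟙 _) _ _)
    have := iso (prod.fst : (Z : C) ⨯ Y ⟶ Z)
    exact inv (prod.fst : (Z : C) ⨯ Y ⟶ Z) ≫ prod.snd
  refine ⟨hI.hasInitial, ⟨fun {I A} f hI' ↦ ?_⟩⟩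
  have := iso (f ≫ hI'.to Z)
  have := iso (hI'.to (Z : C))
  exact IsIso.of_isIso_comp_right f (hI'.to Z)

end Initial

end CategoryTheory

/-- For a finitely complete category `C`, the following are equivalent:
(i) `C` has a strict initial object and, for every pair of monomorphisms `a : A ⟶ X`,
`b : B ⟶ X` with intersection (pullback) `A ∩ B`, the pushout `A +_{A∩B} B` exists and is
stable under pullback; (ii) `C` admits finite unions of subobjects (a least subobject of
every object and binary joins of subobjects) which are stable under pullback and effective. -/
theorem stmt0 {C : Type u} [Category.{v} C] [HasFiniteLimits C] :
    ((HasInitial C ∧ HasStrictInitialObjects C) ∧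
      ∀ {A B X : C} (a : A ⟶ X) (b : B ⟶ X) [Mono a] [Mono b],
        ∃ (D : C) (f : A ⟶ D) (g : B ⟶ D)
          (H : IsPushout (pullback.fst a b) (pullback.snd a b) f g),
          IsUniversalColimit (PushoutCocone.mk f g H.w)) ↔
    ((∀ X : C, ∃ Z : Subobject X,
        (∀ S : Subobject X, Z ≤ S) ∧
        ∀ {Y : C} (f : Y ⟶ X) (S : Subobject Y), (Subobject.pullback f).obj Z ≤ S) ∧
      (∀ (X : C) (S T : Subobject X), ∃ U : Subobject X,
        ∃ (hS : S ≤ U) (hT : T ≤ U),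
          (∀ V : Subobject X, S ≤ V → T ≤ V → U ≤ V) ∧
          (∀ {Y : C} (f : Y ⟶ X),
            (Subobject.pullback f).obj S ≤ (Subobject.pullback f).obj U ∧
            (Subobject.pullback f).obj T ≤ (Subobject.pullback f).obj U ∧
            ∀ V : Subobject Y, (Subobject.pullback f).obj S ≤ V →
              (Subobject.pullback f).obj T ≤ V → (Subobject.pullback f).obj U ≤ V) ∧
          IsPushout (Subobject.ofLE (S ⊓ T) S inf_le_left)
            (Subobject.ofLE (S ⊓ T) T inf_le_right)
            (Subobject.ofLE S U hS) (Subobject.ofLE T U hT))) := by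
  constructor
  · rintro ⟨⟨_, _⟩, hpo⟩
    refine ⟨fun X ↦ ⟨Subobject.mk (initial.to X), fun S ↦ ?_, fun {Y} f S ↦ ?_⟩, fun X S T ↦ ?_⟩
    · exact Subobject.mk_le_of_comm (initial.to _) (initialIsInitial.hom_ext _ _)
    · let φ := Subobject.pullbackπ f (Subobject.mk (initial.to X)) ≫
        (Subobject.underlyingIso (initial.to X)).hom
      refine Subobject.le_of_comm (φ ≫ initial.to _) ?_
      rw [← cancel_epi (inv φ)]
      exact initialIsInitial.hom_ext _ _
    · obtain ⟨D, f, g, H, hu⟩ := hpo S.arrow T.arrow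
      rw [← H.isUniversal_iff] at hu
      let k : D ⟶ X := H.desc S.arrow T.arrow pullback.condition
      have hf : f ≫ k = S.arrow := H.inl_desc _ _ _
      have hg : g ≫ k = T.arrow := H.inr_desc _ _ _
      have : Mono k := hu.mono_of_isPullback (IsPullback.of_hasPullback _ _) hf hg
      have hS : S ≤ Subobject.mk k := Subobject.le_mk_of_comm f hf
      have hT : T ≤ Subobject.mk k := Subobject.le_mk_of_comm g hg
      have stable : ∀ {Y : C} (φ : Y ⟶ X) (V : Subobject Y), (Subobject.pullback φ).obj S ≤ V →
          (Subobject.pullback φ).obj T ≤ V →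
            (Subobject.pullback φ).obj (Subobject.mk k) ≤ V := fun φ V ↦
        hu.pullback_mk_le k (by rw [hf]; exact Subobject.factors_self S)
          (by rw [hg]; exact Subobject.factors_self T) φ
      refine ⟨Subobject.mk k, hS, hT, fun V hSV hTV ↦ ?_, fun φ ↦ ⟨?_, ?_, stable φ⟩, ?_⟩
      · simpa only [Subobject.pullback_id] using
          stable (𝟙 X) V (by rwa [Subobject.pullback_id]) (by rwa [Subobject.pullback_id])
      · exact (Subobject.pullback φ).monotone hS
      · exact (Subobject.pullback φ).monotone hT
      · refine H.of_iso (Subobject.inf_isPullback S T).isoPullback.symm (Iso.refl _) (Iso.refl _)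
          (Subobject.underlyingIso k).symm (by simp) (by simp) ?_ ?_
        · simp [← cancel_mono (Subobject.mk k).arrow, hf]
        · simp [← cancel_mono (Subobject.mk k).arrow, hg]
  · rintro ⟨hbot, hsup⟩
    obtain ⟨Z, -, hZ⟩ := hbot (⊤_ C)
    refine ⟨hasStrictInitialObjects_of_forall_pullback_le hZ, fun {A B X} a b _ _ ↦ ?_⟩
    obtain ⟨U, ha, hb, -, hst, hU⟩ := hsup X (Subobject.mk a) (Subobject.mk b)
    have hab := IsPullback.of_hasPullback a b
    have H := Subobject.isPushout_of_isPullback hab ha hb hU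
    refine ⟨U, _, _, H, H.isUniversal_iff.1 ?_⟩
    intro W' A' B' Y p' q' a' b' αW αA αB αY hp hq ha' hb' w
    have haY : IsPullback a' αA (αY ≫ U.arrow) a := by
      simpa using ha'.paste_vert (IsPullback.of_vert_isIso_mono (snd := 𝟙 A) ⟨by simp⟩)
    have hbY : IsPullback b' αB (αY ≫ U.arrow) b := by
      simpa using hb'.paste_vert (IsPullback.of_vert_isIso_mono (snd := 𝟙 B) ⟨by simp⟩)
    have := haY.mono_fst_of_mono
    have := hbY.mono_fst_of_mono
    have hab' : IsPullback p' q' a' b' := by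
      refine IsPullback.of_bot ?_ w.w hbY
      rw [hq.w, haY.w]
      exact hp.paste_vert hab
    obtain ⟨U', ha₁, hb₁, -, -, hU'⟩ := hsup Y (Subobject.mk a') (Subobject.mk b')
    have H' := Subobject.isPushout_of_isPullback hab' ha₁ hb₁ hU'
    have top : U' = ⊤ := by
      have le := (hst (αY ≫ U.arrow)).2.2 U'
        ((Subobject.pullback_obj_mk haY.flip).trans_le ha₁)
        ((Subobject.pullback_obj_mk hbY.flip).trans_le hb₁)
      rwa [Subobject.pullback_comp, Subobject.pullback_arrow_self, Subobject.pullback_top,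
        top_le_iff] at le
    have : IsIso U'.arrow := by rw [Subobject.isIso_arrow_iff_eq_top, top]
    exact H'.of_iso (Iso.refl _) (Iso.refl _) (Iso.refl _) (asIso U'.arrow) (by simp) (by simp)
      (by simp) (by simp)
end

section
/- Let 𝒞 be a finitely complete category in which, for every pair of monomorphisms a : A ↪ C and b : B ↪ C with pullback (intersection) A ∩ B, the pushout A +_{A∩B} B of the span A ↩ A∩B ↪ B exists and is stable under pullback. Then for any two monomorphisms a : A ↪ C and b : B ↪ C, the canonical morphism k : A +_{A∩B} B → C induced by a and b is a monomorphism. -/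
open CategoryTheory CategoryTheory.Limits

universe v u

/-- The pullback projections of a universal colimit cocone are jointly epimorphic. -/
theorem CategoryTheory.IsUniversalColimit.hom_ext_of_isPullback {J : Type*} [Category* J]
    {C : Type*} [Category* C] {F : J ⥤ C} {c : Cocone F}
    (hc : IsUniversalColimit c) {T Z : C} {p : T ⟶ c.pt} {P : J → C}
    {fst : ∀ j, P j ⟶ T} {snd : ∀ j, P j ⟶ F.obj j}
    (hP : ∀ j, IsPullback (fst j) (snd j) p (c.ι.app j)) {s t : T ⟶ Z}
    (h : ∀ j, fst j ≫ s = fst j ≫ t) : s = t := by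
  have w {i j : J} (g : i ⟶ j) : fst i ≫ p = (snd i ≫ F.map g) ≫ c.ι.app j :=
    (hP i).w.trans (by rw [Category.assoc, c.w])
  let F' : J ⥤ C :=
    { obj := P
      map {i j} g := (hP j).lift (fst i) (snd i ≫ F.map g) (w g)
      map_id j := (hP j).hom_ext (by simp) (by simp)
      map_comp {i j k} g g' := (hP k).hom_ext (by simp) (by simp) }
  let c' : Cocone F' :=
    { pt := T
      ι := { app := fst
             naturality i j g := ((hP j).lift_fst _ _ (w g)).trans (Category.comp_id _).symm } }
  let α : F' ⟶ F :=
    { app := snd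
      naturality i j g := (hP j).lift_snd _ _ (w g) }
  have hα : NatTrans.Equifibered α := fun i j g ↦ by
    refine IsPullback.of_right (t := hP j) ?_ (α.naturality g)
    exact (hP i).of_iso (Iso.refl _) (Iso.refl _) (Iso.refl _) (Iso.refl _)
      ((Category.comp_id _).trans <| (c'.w g).symm.trans (Category.id_comp _).symm)
      (by simp [α]) (by simp) (by simp)
  obtain ⟨hc'⟩ := hc c' α p (by ext j; exact (hP j).w.symm) hα hP
  exact hc'.hom_ext h

/-- To check that two morphisms out of `T` agree, when `T` maps to the vertex of a universal
pushout, it suffices to do so on the pullbacks of the two legs. -/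
theorem CategoryTheory.IsUniversalColimit.hom_ext_of_pushout {C : Type*} [Category* C]
    [HasPullbacks C] {W A B D : C} {i : W ⟶ A} {j : W ⟶ B} {f : A ⟶ D} {g : B ⟶ D}
    {w : i ≫ f = j ≫ g} (hD : IsUniversalColimit (PushoutCocone.mk f g w))
    {T Z : C} (p : T ⟶ D) {s t : T ⟶ Z}
    (hf : ∀ {S : C} (e : S ⟶ T) (x : S ⟶ A), e ≫ p = x ≫ f → e ≫ s = e ≫ t)
    (hg : ∀ {S : C} (e : S ⟶ T) (y : S ⟶ B), e ≫ p = y ≫ g → e ≫ s = e ≫ t) : s = t := by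
  refine hD.hom_ext_of_isPullback (fun k ↦ IsPullback.of_hasPullback p _) ?_
  rintro (_ | _ | _)
  · exact hf _ (pullback.snd p (i ≫ f) ≫ i)
      (pullback.condition.trans (Category.assoc _ _ _).symm)
  · exact hf _ (pullback.snd p f) pullback.condition
  · exact hg _ (pullback.snd p g) pullback.condition

/-- If the pushout of `A ⟵ A ∩ B ⟶ B` is universal, then the induced morphism to the ambient
object is a monomorphism. -/
theorem CategoryTheory.IsUniversalColimit.mono_pushout_desc {C : Type*} [Category* C]
    [HasPullbacks C] {A B X : C} {a : A ⟶ X} {b : B ⟶ X} [Mono a] [Mono b]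
    {D : C} {f : A ⟶ D} {g : B ⟶ D}
    (H : IsPushout (pullback.fst a b) (pullback.snd a b) f g)
    (hD : IsUniversalColimit (PushoutCocone.mk f g H.w)) :
    Mono (H.desc a b pullback.condition) := by
  have mixed {S : C} (x : S ⟶ A) (y : S ⟶ B) (h : x ≫ a = y ≫ b) : x ≫ f = y ≫ g := by
    rw [← pullback.lift_fst x y h, Category.assoc, H.w, pullback.lift_snd_assoc]
  refine ⟨fun {T} s t hst ↦ ?_⟩
  refine hD.hom_ext_of_pushout s (fun e x hx ↦ ?_) (fun e y hy ↦ ?_)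
  · have key := e ≫= hst
    rw [reassoc_of% hx, H.inl_desc] at key
    refine hD.hom_ext_of_pushout (e ≫ t) (fun e' x' hx' ↦ ?_) (fun e' y' hy' ↦ ?_)
    · have key' := e' ≫= key
      rw [reassoc_of% hx', H.inl_desc, ← Category.assoc, cancel_mono] at key'
      rw [hx, hx', ← key', Category.assoc]
    · have key' := e' ≫= key
      rw [reassoc_of% hy', H.inr_desc, ← Category.assoc] at key'
      rw [hx, hy', ← mixed _ _ key', Category.assoc]
  · have key := e ≫= hst
    rw [reassoc_of% hy, H.inr_desc] at key
    refine hD.hom_ext_of_pushout (e ≫ t) (fun e' x' hx' ↦ ?_) (fun e' y' hy' ↦ ?_)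
    · have key' := e' ≫= key
      rw [reassoc_of% hx', H.inl_desc, ← Category.assoc] at key'
      rw [hy, hx', mixed _ _ key'.symm, Category.assoc]
    · have key' := e' ≫= key
      rw [reassoc_of% hy', H.inr_desc, ← Category.assoc, cancel_mono] at key'
      rw [hy, hy', ← key', Category.assoc]

/-- If `C` is finitely complete and, for every pair of monomorphisms
`a : A ⟶ X`, `b : B ⟶ X`, the pushout of the span `A ⟵ A ∩ B ⟶ B` (where `A ∩ B` is the
pullback of `a` and `b`) exists and is stable under pullback, then for any two monomorphisms
`a`, `b` into `X`, the canonical morphism `k : A +_{A∩B} B ⟶ X` induced by `a` and `b` is a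
monomorphism. -/
theorem stmt1 {C : Type u} [Category.{v} C] [HasFiniteLimits C]
    (hpo : ∀ {A B X : C} (a : A ⟶ X) (b : B ⟶ X) [Mono a] [Mono b],
      ∃ (D : C) (f : A ⟶ D) (g : B ⟶ D)
        (H : IsPushout (pullback.fst a b) (pullback.snd a b) f g),
        IsUniversalColimit (PushoutCocone.mk f g H.w))
    {A B X : C} (a : A ⟶ X) (b : B ⟶ X) [Mono a] [Mono b]
    {D : C} (f : A ⟶ D) (g : B ⟶ D)
    (H : IsPushout (pullback.fst a b) (pullback.snd a b) f g) :
    Mono (H.desc a b pullback.condition) := by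
  
  obtain ⟨D', f', g', H', hD'⟩ := hpo a b
  exact IsUniversalColimit.mono_pushout_desc H
    (hD'.of_iso (hD'.isColimit.uniqueUpToIso H.isColimit))
end

section
/- A category 𝒞 with finite limits and with pushouts along monomorphisms is adhesive if and only if pushouts along monomorphisms in 𝒞 are stable under pullback and every pushout square along a monomorphism in 𝒞 is also a pullback square. -/
open CategoryTheory CategoryTheory.Limits

universe v u

namespace CategoryTheory

/-- A category with pullbacks and with pushouts along monomorphisms, such that these pushouts are
stable under pullback and are themselves pullback squares. -/
class HasStableMonoPushouts (C : Type u) [Category.{v} C] : Prop extends HasPullbacks C where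
  hasPushout {X A B : C} (m : X ⟶ A) (f : X ⟶ B) [Mono m] : HasPushout m f
  isUniversalColimit {X A B P : C} {m : X ⟶ A} {f : X ⟶ B} {g : A ⟶ P} {h : B ⟶ P} [Mono m]
    (H : IsPushout m f g h) : IsUniversalColimit (PushoutCocone.mk g h H.w)
  isPullback {X A B P : C} {m : X ⟶ A} {f : X ⟶ B} {g : A ⟶ P} {h : B ⟶ P} [Mono m] :
    IsPushout m f g h → IsPullback m f g h

theorem IsPushout.of_isUniversalColimit {C : Type u} [Category.{v} C] {W X Y Z : C}
    {f : W ⟶ X} {g : W ⟶ Y} {h : X ⟶ Z} {i : Y ⟶ Z} {H : IsPushout f g h i}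
    (H' : IsUniversalColimit (PushoutCocone.mk h i H.w)) {W' X' Y' Z' : C}
    {f' : W' ⟶ X'} {g' : W' ⟶ Y'} {h' : X' ⟶ Z'} {i' : Y' ⟶ Z'} {αW : W' ⟶ W}
    {αX : X' ⟶ X} {αY : Y' ⟶ Y} {αZ : Z' ⟶ Z} (hf : IsPullback f' αW αX f)
    (hg : IsPullback g' αW αY g) (hh : IsPullback h' αX αZ h) (hi : IsPullback i' αY αZ i)
    (w : f' ≫ h' = g' ≫ i') : IsPushout f' g' h' i' := by
  have w : CommSq f' g' h' i' := ⟨w⟩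
  refine ⟨w, H' w.cocone ⟨by rintro (_ | _ | _); exacts [αW, αX, αY], ?_⟩ αZ ?_ ?_ ?_⟩
  · rintro i _ (_ | _ | _)
    · dsimp; simp only [Functor.map_id, Category.comp_id, Category.id_comp]
    exacts [hf.w, hg.w]
  · ext (_ | _ | _)
    · change αW ≫ f ≫ h = (f' ≫ h') ≫ αZ
      rw [Category.assoc, hh.w, hf.w_assoc]
    exacts [hh.w.symm, hi.w.symm]
  · rintro i _ (_ | _ | _)
    · dsimp; simp_rw [Functor.map_id]
      exact IsPullback.of_horiz_isIso ⟨by rw [Category.comp_id, Category.id_comp]⟩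
    exacts [hf, hg]
  · rintro (_ | _ | _)
    · dsimp; rw [PushoutCocone.condition_zero]; exact hf.paste_horiz hh
    exacts [hh, hi]

namespace HasStableMonoPushouts

variable {C : Type u} [Category.{v} C] [HasStableMonoPushouts C]

attribute [local simp] pullback.lift_fst pullback.lift_snd pullback.lift_fst_assoc
  pullback.lift_snd_assoc

section

variable {X A B P : C} {m : X ⟶ A} {f : X ⟶ B} {g : A ⟶ P} {h : B ⟶ P} [Mono m]

theorem isPushout_of_isPullback (H : IsPushout m f g h) {X' A' B' P' : C}
    {m' : X' ⟶ A'} {f' : X' ⟶ B'} {g' : A' ⟶ P'} {h' : B' ⟶ P'} {x : X' ⟶ X}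
    {a : A' ⟶ A} {b : B' ⟶ B} {p : P' ⟶ P} (hm : IsPullback m' x a m)
    (hg : IsPullback g' a p g) (hh : IsPullback h' b p h)
    (w : m' ≫ g' = f' ≫ h') (w' : f' ≫ b = x ≫ f) : IsPushout m' f' g' h' := by
  refine .of_isUniversalColimit (H := H) (isUniversalColimit H) hm (.of_right ?_ w' hh) hg hh w
  rw [← w, ← H.w]
  exact hm.paste_horiz hg

theorem hom_ext_of_isPushout (H : IsPushout m f g h) {T Z : C} (x : T ⟶ P) {k l : T ⟶ Z}
    (h₁ : ∀ ⦃E : C⦄ (e : E ⟶ T) (a : E ⟶ A), e ≫ x = a ≫ g → e ≫ k = e ≫ l)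
    (h₂ : ∀ ⦃E : C⦄ (e : E ⟶ T) (b : E ⟶ B), e ≫ x = b ≫ h → e ≫ k = e ≫ l) : k = l := by
  have hw : (pullback.fst (pullback.snd x g) m ≫ pullback.fst x g) ≫ x =
      (pullback.snd (pullback.snd x g) m ≫ f) ≫ h := by
    simp only [Category.assoc, pullback.condition, pullback.condition_assoc, H.w]
  have K := isPushout_of_isPullback H (.of_hasPullback (pullback.snd x g) m)
    (.of_hasPullback x g) (.of_hasPullback x h) (f' := pullback.lift _ _ hw)
    (by simp) (by simp)
  exact K.hom_ext (h₁ _ _ pullback.condition) (h₂ _ _ pullback.condition)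

theorem mono_inr (H : IsPushout m f g h) : Mono h := by
  have K := isPushout_of_isPullback H (IsKernelPair.id_of_mono m)
    (isPullback H).flip (.of_hasPullback h h) (f' := pullback.lift f f rfl)
    (by simp) (by simp)
  have := K.isIso_inr_of_isIso
  exact IsKernelPair.mono_of_isIso_fst (IsPullback.of_hasPullback h h)

end

theorem isIso_of_isPushout_comp {X A A' B P : C} {m : X ⟶ A} {f : X ⟶ B} {g : A ⟶ P}
    {h : B ⟶ P} {m' : X ⟶ A'} {a : A' ⟶ A} {g' : A' ⟶ P} [Mono a]
    (H : IsPushout m f g h) (H' : IsPushout m' f g' h) (hm : m' ≫ a = m) (hg : a ≫ g = g') :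
    IsIso a := by
  have K : IsPushout a g' g (𝟙 P) :=
    .of_left (by simpa [hm] using H) (by simp [hg]) H'
  exact (isPullback K).isIso_fst_of_isIso

/-- The union of two subobjects, computed as the pushout over their intersection, is again a
subobject. -/
theorem mono_of_isPushout_of_isPullback {W A B P Z : C} {p : W ⟶ A} {q : W ⟶ B}
    {u : A ⟶ P} {v : B ⟶ P} {a : A ⟶ Z} {b : B ⟶ Z} [Mono a] [Mono b]
    (H : IsPushout p q u v) (K : IsPullback p q a b) {w : P ⟶ Z} (hu : u ≫ w = a)
    (hv : v ≫ w = b) : Mono w := by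
  have : Mono p := K.mono_fst_of_mono
  subst hu hv
  constructor
  intro T s t hst
  have key {E : C} (s t : E ⟶ P) (hst : s ≫ w = t ≫ w) (x : E ⟶ A) (y : E ⟶ B)
      (hx : s = x ≫ u) (hy : t = y ≫ v) : s = t := by
    subst hx hy
    simp only [Category.assoc] at hst
    rw [← K.lift_fst x y hst, Category.assoc, H.w, K.lift_snd_assoc]
  refine hom_ext_of_isPushout H s (fun E e x hx ↦ ?_) (fun E e x hx ↦ ?_)
  all_goals
    refine hom_ext_of_isPushout H (e ≫ t) (fun F j y hy ↦ ?_) (fun F j y hy ↦ ?_)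
    all_goals
      have hjx := congr(j ≫ $hx)
      have hjw := congr(j ≫ e ≫ $hst)
      simp only [← Category.assoc] at hjx hjw hy ⊢
  · rw [hjx, hy, Category.assoc _ u, Category.assoc _ u, cancel_mono] at hjw
    rw [hjx, hy, hjw]
  · exact key _ _ hjw _ _ hjx hy
  · exact (key _ _ hjw.symm _ _ hy hjx).symm
  · rw [hjx, hy, Category.assoc _ v, Category.assoc _ v, cancel_mono] at hjw
    rw [hjx, hy, hjw]

section

variable {X A B P : C} {m : X ⟶ A} {f : X ⟶ B} {g : A ⟶ P} {h : B ⟶ P} [Mono m]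

/-- If `P` is the pushout of a monomorphism `m : X ⟶ A` along `f : X ⟶ B`, then the kernel pair
of `A ⟶ P` is the union of the diagonal of `A` and of the kernel pair of `f`. -/
theorem isPushout_pullback_map (H : IsPushout m f g h) :
    IsPushout m (pullback.diagonal f) (pullback.diagonal g)
      (pullback.map f f g g m m h H.w.symm H.w.symm) := by
  have := mono_inr H
  have hmm : Mono (pullback.map f f g g m m h H.w.symm H.w.symm) :=
    ⟨fun k l e ↦ by
      have h₁ := congr($e ≫ pullback.fst _ _)
      have h₂ := congr($e ≫ pullback.snd _ _)
      simp only [Category.assoc, pullback.lift_fst, pullback.lift_snd] at h₁ h₂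
      simp only [← Category.assoc, cancel_mono] at h₁ h₂
      exact pullback.hom_ext h₁ h₂⟩
  have K := isPullback H
  have H₁ : IsPushout (pullback.map f f g g m m h H.w.symm H.w.symm) (pullback.fst f f)
      (pullback.fst g g) m := by
    refine isPushout_of_isPullback H (x := pullback.snd f f) (a := pullback.snd g g)
      (p := g) (b := f) (.of_right ?_ (by simp) (.of_hasPullback g g)) (.of_hasPullback g g)
      K (by simp) pullback.condition
    simpa [H.w] using (IsPullback.of_hasPullback f f).paste_horiz K
  have := hasPushout m (pullback.diagonal f)
  have hw : m ≫ pullback.diagonal g = pullback.diagonal f ≫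
      pullback.map f f g g m m h H.w.symm H.w.symm := by
    ext <;> simp
  have K₁ : IsPullback m (pullback.diagonal f) (pullback.diagonal g)
      (pullback.map f f g g m m h H.w.symm H.w.symm) := by
    refine .mk' hw (fun _ _ _ e _ ↦ by simpa [cancel_mono] using e)
      fun T x y hxy ↦ ?_
    have h₁ := congr($hxy ≫ pullback.fst _ _)
    have h₂ := congr($hxy ≫ pullback.snd _ _)
    simp at h₁ h₂
    rw [h₁, ← Category.assoc, ← Category.assoc, cancel_mono] at h₂
    exact ⟨y ≫ pullback.fst f f, by simp [h₁], by ext <;> simp [h₂]⟩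
  let w := pushout.desc _ _ hw
  have hw₁ : pushout.inl _ _ ≫ w = _ := pushout.inl_desc _ _ hw
  have hw₂ : pushout.inr _ _ ≫ w = _ := pushout.inr_desc _ _ hw
  have H₂ := IsPushout.of_hasPushout m (pullback.diagonal f)
  have : Mono w := mono_of_isPushout_of_isPullback H₂ K₁ hw₁ hw₂
  have H₃ : IsPushout (pushout.inr m (pullback.diagonal f)) (pullback.fst f f)
      (w ≫ pullback.fst g g) m := by
    refine .flip (.of_left (h₁₁ := pullback.diagonal f) (v₁₁ := m) (h₂₁ := pushout.inl _ _)
      ?_ ?_ H₂.flip)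
    · simpa [reassoc_of% hw₁] using IsPushout.of_id_fst (f := m)
    · simp [reassoc_of% hw₂]
  have := isIso_of_isPushout_comp H₁ H₃ hw₂ rfl
  exact H₂.of_iso (.refl _) (.refl _) (.refl _) (asIso w) (by simp) (by simp) (by simpa)
    (by simpa)

theorem mono_of_isPushout {X' A' B' : C} {m' : X' ⟶ A'} {f' : X' ⟶ B'} {g' : A' ⟶ P}
    {h' : B' ⟶ P} [Mono m'] {x : X' ⟶ X} {a : A' ⟶ A} [Mono x]
    (H : IsPushout m' f' g' h') (hm : m' ≫ a = x ≫ m) (hg : a ≫ g = g') : Mono a := by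
  subst hg
  constructor
  intro T k l hkl
  have hkl' : k ≫ a ≫ g = l ≫ a ≫ g := by simp only [reassoc_of% hkl]
  refine hom_ext_of_isPushout (isPushout_pullback_map H) (pullback.lift k l hkl')
    (fun E e y hy ↦ ?_) (fun E e y hy ↦ ?_)
  · have h₁ := congr($hy ≫ pullback.fst _ _)
    have h₂ := congr($hy ≫ pullback.snd _ _)
    simp only [Category.assoc, pullback.lift_fst, pullback.lift_snd, pullback.diagonal_fst,
      pullback.diagonal_snd] at h₁ h₂
    rw [h₁, h₂]
  · have h₁ := congr($hy ≫ pullback.fst _ _)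
    have h₂ := congr($hy ≫ pullback.snd _ _)
    simp only [Category.assoc, pullback.lift_fst, pullback.lift_snd] at h₁ h₂
    have h₃ := congr(e ≫ $hkl)
    rw [reassoc_of% h₁, reassoc_of% h₂] at h₃
    simp only [hm, ← Category.assoc, cancel_mono] at h₃
    rw [h₁, h₂, reassoc_of% h₃]

/-- Two pushouts of monomorphisms with the same vertex are isomorphic as soon as one is
obtained from the other by pullback of the legs. -/
theorem isIso_of_isPushout {X' A' B' : C} {m' : X' ⟶ A'} {f' : X' ⟶ B'} {g' : A' ⟶ P}
    {h' : B' ⟶ P} {x : X' ⟶ X} {a : A' ⟶ A} {b : B' ⟶ B}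
    (H : IsPushout m f g h) (H' : IsPushout m' f' g' h') (hm : IsPullback m' x a m)
    (hf : IsPullback f' x b f) (hg : a ≫ g = g') (hh : b ≫ h = h') : IsIso a ∧ IsIso b := by
  have : Mono m' := hm.mono_fst_of_mono
  have := mono_inr H
  have hb : IsIso b := by
    have K := isPushout_of_isPullback H' (IsKernelPair.id_of_mono m') (p := h)
      (g' := x ≫ f) (f' := f') (h' := b) (b := 𝟙 B') ?_ ?_ ?_ ?_
    · exact K.isIso_inr_of_isIso
    · rw [← hg]
      exact hm.flip.paste_horiz (isPullback H).flip
    · exact .mk' (by simp [hh]) (fun _ _ _ _ e ↦ by simpa using e) fun _ y z e ↦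
        ⟨z, by rw [← cancel_mono h, Category.assoc, hh, e], by simp⟩
    · simp [hf.w]
    · simp
  have hx : IsIso x := hf.isIso_snd_of_isIso
  have : Mono a := mono_of_isPushout H' hm.w hg
  refine ⟨isIso_of_isPushout_comp (m := m' ≫ a) ?_ H' rfl hg, hb⟩
  exact H.of_iso (asIso x).symm (.refl _) (asIso b).symm (.refl _) (by simp [hm.w]) (by
    simp [← hf.w_assoc]) (by simp) (by simp [← hh])

theorem isVanKampen (H : IsPushout m f g h) : H.IsVanKampen := by
  intro X' A' B' P' m' f' g' h' x a b p hm hf hg hh w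
  refine ⟨fun H' ↦ ?_, fun ⟨hg', hh'⟩ ↦
    isPushout_of_isPullback H hm hg' hh' w.w hf.w⟩
  have hw : (pullback.fst (pullback.snd p g) m ≫ pullback.fst p g) ≫ p =
      (pullback.snd (pullback.snd p g) m ≫ f) ≫ h := by
    simp only [Category.assoc, pullback.condition, pullback.condition_assoc, H.w]
  have hm₂ := IsPullback.of_hasPullback (pullback.snd p g) m
  have hg₂ := IsPullback.of_hasPullback p g
  have hh₂ := IsPullback.of_hasPullback p h
  have K := isPushout_of_isPullback H hm₂ hg₂ hh₂ (f' := pullback.lift _ _ hw)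
    (by simp) (by simp)
  have hf₂ : IsPullback (pullback.lift _ _ hw) (pullback.snd (pullback.snd p g) m)
      (pullback.snd p h) f := by
    refine .of_right ?_ (by simp) hh₂
    simpa [← H.w] using hm₂.paste_horiz hg₂
  let a' := pullback.lift g' a hg.w
  let b' := pullback.lift h' b hh.w
  have ha' : a' ≫ pullback.snd p g = a := by simp [a']
  have hb' : b' ≫ pullback.snd p h = b := by simp [b']
  let x' := hm₂.lift (m' ≫ a') x (by simp [ha', hm.w])
  have hx' : x' ≫ pullback.snd (pullback.snd p g) m = x := hm₂.lift_snd _ _ _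
  have hx'' : x' ≫ pullback.fst (pullback.snd p g) m = m' ≫ a' := hm₂.lift_fst _ _ _
  have hm₁ : IsPullback m' x' a' (pullback.fst (pullback.snd p g) m) :=
    .of_bot (by simpa [ha', hx'] using hm) hx''.symm hm₂
  have hf₁ : IsPullback f' x' b' (pullback.lift _ _ hw) := by
    refine .of_bot (by simpa [hb', hx'] using hf) (hh₂.hom_ext ?_ ?_) hf₂
    · simp [b', reassoc_of% hx'', a', w.w]
    · simp [hb', reassoc_of% hx', hf.w]
  obtain ⟨_, _⟩ := isIso_of_isPushout K H' hm₁ hf₁ (pullback.lift_fst _ _ _)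
    (pullback.lift_fst _ _ _)
  exact ⟨.of_iso_pullback hg (asIso a') (by simp [a']) (by simp [a']),
    .of_iso_pullback hh (asIso b') (by simp [b']) (by simp [b'])⟩

end

end HasStableMonoPushouts

end CategoryTheory

/-- A category `C` with finite limits and with pushouts along monomorphisms
is adhesive if and only if pushouts along monomorphisms in `C` are stable under pullback and
every pushout square along a monomorphism in `C` is also a pullback square. -/
theorem stmt2 {C : Type u} [Category.{v} C] [HasFiniteLimits C]
    (hpo : ∀ {X A B : C} (m : X ⟶ A) (f : X ⟶ B) [Mono m], HasPushout m f) :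
    Adhesive C ↔
      ((∀ {X A B P : C} (m : X ⟶ A) (f : X ⟶ B) (g : A ⟶ P) (h : B ⟶ P) [Mono m]
          (H : IsPushout m f g h), IsUniversalColimit (PushoutCocone.mk g h H.w)) ∧
        (∀ {X A B P : C} (m : X ⟶ A) (f : X ⟶ B) (g : A ⟶ P) (h : B ⟶ P) [Mono m],
          IsPushout m f g h → IsPullback m f g h)) := by
  constructor
  · intro _
    exact ⟨fun _ _ _ _ _ H ↦ (H.isVanKampen_iff.mp (Adhesive.van_kampen H)).isUniversal,
      fun _ _ _ _ _ H ↦ Adhesive.isPullback_of_isPushout_of_mono_left H⟩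
  · intro ⟨hu, hp⟩
    have : HasStableMonoPushouts C :=
      { hasPushout := hpo
        isUniversalColimit := hu _ _ _ _
        isPullback := hp _ _ _ _ }
    exact { hasPushout_of_mono_left := hpo, van_kampen := HasStableMonoPushouts.isVanKampen }
end

section
/- Let 𝒞 be a category with finite limits in which pushouts along monomorphisms exist, are stable under pullback, and in which every pushout square along a monomorphism is also a pullback square. Then monomorphisms in 𝒞 are stable under pushout: if a commutative square with edges m : C → A, f : C → B, g : A → D, n : B → D is a pushout and m is a monomorphism, then n is a monomorphism. -/
open CategoryTheory CategoryTheory.Limits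

universe v u

/-- A universal pushout square stays a pushout after pulling it back along a morphism into its
vertex: in a commutative cube over it whose back and front faces are pullbacks, the top face is a
pushout. -/
theorem isPushout_of_isUniversalColimit {C : Type u} [Category.{v} C]
    {W X Y Z W' X' Y' Z' : C} {f : W ⟶ X} {g : W ⟶ Y} {h : X ⟶ Z} {i : Y ⟶ Z} (w : f ≫ h = g ≫ i)
    (H : IsUniversalColimit (PushoutCocone.mk h i w))
    {f' : W' ⟶ X'} {g' : W' ⟶ Y'} {h' : X' ⟶ Z'} {i' : Y' ⟶ Z'}
    {αW : W' ⟶ W} {αX : X' ⟶ X} {αY : Y' ⟶ Y} {αZ : Z' ⟶ Z}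
    (w' : f' ≫ h' = g' ≫ i')
    (hf : IsPullback f' αW αX f) (hg : IsPullback g' αW αY g)
    (hh : IsPullback h' αX αZ h) (hi : IsPullback i' αY αZ i) :
    IsPushout f' g' h' i' := by
  refine ⟨⟨w'⟩, H (PushoutCocone.mk h' i' w')
    ⟨by rintro (_ | _ | _); exacts [αW, αX, αY], ?_⟩ αZ ?_ ?_ ?_⟩
  · rintro i _ (_ | _ | _)
    · rcases i with _ | _ | _ <;> exact (Category.id_comp _).trans (Category.comp_id _).symm
    exacts [hf.w, hg.w]
  · ext (_ | _ | _)
    · exact (hf.paste_horiz hh).w.symm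
    exacts [hh.w.symm, hi.w.symm]
  · rintro i _ (_ | _ | _)
    · rcases i with _ | _ | _
      exacts [IsPullback.id_horiz αW, IsPullback.id_horiz αX, IsPullback.id_horiz αY]
    exacts [hf, hg]
  · rintro (_ | _ | _)
    · exact hf.paste_horiz hh
    exacts [hh, hi]

/-- Let `C` be a category with finite limits in which pushouts along
monomorphisms exist, are stable under pullback, and in which every pushout square along a
monomorphism is also a pullback square.  Then monomorphisms are stable under pushout: if a
commutative square with edges `m : X ⟶ A`, `f : X ⟶ B`, `g : A ⟶ P`, `n : B ⟶ P` is a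
pushout and `m` is a monomorphism, then `n` is a monomorphism. -/
theorem stmt3 {C : Type u} [Category.{v} C] [HasFiniteLimits C]
    (hpo : ∀ {X A B : C} (m : X ⟶ A) (f : X ⟶ B) [Mono m], HasPushout m f)
    (hstab : ∀ {X A B P : C} (m : X ⟶ A) (f : X ⟶ B) (g : A ⟶ P) (h : B ⟶ P) [Mono m]
      (H : IsPushout m f g h), IsUniversalColimit (PushoutCocone.mk g h H.w))
    (hpb : ∀ {X A B P : C} (m : X ⟶ A) (f : X ⟶ B) (g : A ⟶ P) (h : B ⟶ P) [Mono m],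
      IsPushout m f g h → IsPullback m f g h)
    {X A B P : C} (m : X ⟶ A) (f : X ⟶ B) (g : A ⟶ P) (n : B ⟶ P) [Mono m]
    (H : IsPushout m f g n) : Mono n := by
  have hn : IsPullback (pullback.fst n n) (pullback.snd n n) n n := IsPullback.of_hasPullback n n
  have hm : IsPullback (𝟙 X) (𝟙 X) m m := IsKernelPair.id_of_mono m
  have hg : IsPullback f m n g := (hpb m f g n H).flip
  have hd : IsPullback (hn.lift f f rfl) (𝟙 X) (pullback.snd n n) f := by
    refine IsPullback.of_right ?_ (by rw [hn.lift_snd, Category.id_comp]) hn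
    rw [hn.lift_fst, ← H.w]
    simpa using hm.paste_horiz hg
  have hp : IsPushout (𝟙 X) (hn.lift f f rfl) f (pullback.fst n n) :=
    isPushout_of_isUniversalColimit H.w (hstab m f g n H) (by rw [hn.lift_fst, Category.id_comp]) hm hd hg hn
  have : IsIso (pullback.fst n n) := hp.isIso_inr_of_isIso
  exact IsKernelPair.mono_of_isIso_fst hn
end

section
/- Let 𝒞 be a category with finite limits in which every kernel pair has a coequalizer. Suppose there exist a small category 𝒟 equipped with a Grothendieck topology J and a fully faithful functor F : 𝒞 → Sh(𝒟, J) into the category of Set-valued sheaves on (𝒟, J) such that F preserves finite limits and preserves coequalizers of kernel pairs. Then 𝒞 is a regular category: regular epimorphisms in 𝒞 are stable under pullback (i.e. the pullback of a regular epimorphism along any morphism is again a regular epimorphism). -/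
open CategoryTheory CategoryTheory.Limits

universe v u

namespace CategoryTheory

/-- Epimorphisms of sheaves of types are stable under pullback. -/
lemma Sheaf.epi_of_isPullback {D : Type u} [Category.{v} D] {J : GrothendieckTopology D}
    {P Q R S : Sheaf J (Type (max u v))} {a : P ⟶ Q} {b : P ⟶ R} {f : Q ⟶ S} {g : R ⟶ S}
    (sq : IsPullback a b f g) [hf : Epi f] : Epi b := by
  rw [← Sheaf.isLocallySurjective_iff_epi] at hf ⊢
  refine ⟨fun {U} s ↦ J.superset_covering ?_
    (Presheaf.imageSieve_mem J f.hom (g.hom.app (.op U) s))⟩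
  rintro V i ⟨t, ht⟩
  have sq' := (sq.map (sheafToPresheaf J _)).map ((evaluation _ _).obj (.op V))
  obtain ⟨x, -, hx⟩ := Types.exists_of_isPullback sq' t (R.obj.map i.op s)
    (ht.trans (NatTrans.naturality_apply g.hom i.op s).symm)
  exact ⟨x, hx⟩

/-- A functor preserving the coequalizer of the kernel pair of a regular epimorphism `f` sends `f`
to a regular epimorphism. -/
lemma Functor.isRegularEpi_map {C E : Type*} [Category C] [Category E] (F : C ⥤ E)
    {X Y : C} (f : X ⟶ Y) [IsRegularEpi f] [HasPullback f f]
    [PreservesColimit (parallelPair (pullback.fst f f) (pullback.snd f f)) F] :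
    IsRegularEpi (F.map f) :=
  ⟨⟨Cofork.IsColimit.regularEpi (isColimitCoforkMapOfIsColimit F _
    (IsKernelPair.of_hasPullback f).toCoequalizer')⟩⟩

/-- A fully faithful functor preserving kernel pairs reflects regular epimorphisms. -/
lemma Functor.isRegularEpi_of_map {C E : Type*} [Category C] [Category E] (F : C ⥤ E)
    [F.Full] [F.Faithful] {X Y : C} (f : X ⟶ Y) [HasPullback f f]
    [PreservesLimit (cospan f f) F] [IsRegularEpi (F.map f)] :
    IsRegularEpi f :=
  have k : IsKernelPair (F.map f) _ _ := (IsPullback.of_hasPullback f f).map F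
  ⟨⟨regularEpiOfKernelPair f (isColimitOfIsColimitCoforkMap F _ k.toCoequalizer')⟩⟩

end CategoryTheory

/-- Let `C` be a finitely complete category in which every kernel pair has a
coequalizer.  If there is a small site `(D, J)` and a fully faithful functor
`F : C ⥤ Sh(D, J)` into the category of set-valued sheaves which preserves finite limits and
coequalizers of kernel pairs, then `C` is regular: regular epimorphisms are stable under
pullback. -/
theorem stmt4 {C : Type u} [Category.{v} C] [HasFiniteLimits C]
    (hcoeq : ∀ {X Y : C} (f : X ⟶ Y), HasCoequalizer (pullback.fst f f) (pullback.snd f f))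
    (D : Type v) [SmallCategory D] (J : GrothendieckTopology D)
    (F : C ⥤ Sheaf J (Type v)) (hfull : F.Full) (hfaithful : F.Faithful)
    (hlex : PreservesFiniteLimits F)
    (hpres : ∀ {X Y : C} (f : X ⟶ Y),
      PreservesColimit (parallelPair (pullback.fst f f) (pullback.snd f f)) F) :
    ∀ {X Y Z : C} (f : Y ⟶ X) (g : Z ⟶ X),
      Nonempty (RegularEpi f) → Nonempty (RegularEpi (pullback.snd f g)) := by
  intro X Y Z f g hf
  have : IsRegularEpi f := ⟨hf⟩
  have := hpres f
  have := F.isRegularEpi_map f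
  have : Epi (F.map (pullback.snd f g)) :=
    Sheaf.epi_of_isPullback ((IsPullback.of_hasPullback f g).map F)
  have := IsRegularEpiCategory.regularEpiOfEpi (F.map (pullback.snd f g))
  exact (F.isRegularEpi_of_map (pullback.snd f g)).regularEpi
end

section
/- Let 𝒞 be a category with finite limits in which every internal equivalence relation has a coequalizer. Suppose there exist a small category 𝒟 equipped with a Grothendieck topology J and a fully faithful functor F : 𝒞 → Sh(𝒟, J) into the category of Set-valued sheaves on (𝒟, J) such that F preserves finite limits and preserves coequalizers of internal equivalence relations. Then 𝒞 is Barr-exact: regular epimorphisms in 𝒞 are stable under pullback, and every internal equivalence relation (s, t) : R ⇉ X in 𝒞 is effective, i.e. is the kernel pair of its own coequalizer. -/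
open CategoryTheory CategoryTheory.Limits

universe v u

/-- An internal equivalence relation in a finitely complete category: a parallel pair
`s, t : R ⟶ X` which is jointly monic, reflexive, symmetric and transitive.
For transitivity, the object of composable pairs is the pullback of `s` along `t`,
i.e. `pullback t s` with projections `p = pullback.fst t s` and `q = pullback.snd t s`
satisfying `p ≫ t = q ≫ s`. -/
def IsInternalEquivRel {C : Type u} [Category.{v} C] [HasFiniteLimits C]
    {R X : C} (s t : R ⟶ X) : Prop :=
  Mono (prod.lift s t) ∧
  (∃ r : X ⟶ R, r ≫ s = 𝟙 X ∧ r ≫ t = 𝟙 X) ∧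
  (∃ σ : R ⟶ R, σ ≫ s = t ∧ σ ≫ t = s) ∧
  (∃ τ : pullback t s ⟶ R,
    τ ≫ s = pullback.fst t s ≫ s ∧ τ ≫ t = pullback.snd t s ≫ t)

namespace IsInternalEquivRel

variable {C : Type*} [Category* C] [HasFiniteLimits C] {R X : C} {s t : R ⟶ X}

/-- A left exact functor sends the two legs of an internal equivalence relation to a jointly
monic pair. -/
lemma jointlyMono₂_map (h : IsInternalEquivRel s t) {E : Type*} [Category* E] (G : C ⥤ E)
    [PreservesFiniteLimits G] : JointlyMono₂ (G.map s) (G.map t) where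
  right_cancellation A a b hs ht := by
    have := h.1
    rw [← cancel_mono (G.map (prod.lift s t))]
    refine BinaryFan.IsLimit.hom_ext (mapIsLimitOfPreservesOfIsLimit G _ _ (prodIsProd X X)) ?_ ?_
    · change (a ≫ G.map _) ≫ G.map prod.fst = (b ≫ G.map _) ≫ G.map prod.fst
      simpa only [Category.assoc, ← G.map_comp, prod.lift_fst] using hs
    · change (a ≫ G.map _) ≫ G.map prod.snd = (b ≫ G.map _) ≫ G.map prod.snd
      simpa only [Category.assoc, ← G.map_comp, prod.lift_snd] using ht

/-- An internal equivalence relation, as Mathlib's structure. -/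
noncomputable def equivalenceRelation (h : IsInternalEquivRel s t) : EquivalenceRelation s t where
  toJointlyMono₂ := by simpa using h.jointlyMono₂_map (𝟭 C)
  r := h.2.1.choose
  reflexivity₁ := h.2.1.choose_spec.1
  reflexivity₂ := h.2.1.choose_spec.2
  s := h.2.2.1.choose
  symmetry₁ := h.2.2.1.choose_spec.1
  symmetry₂ := h.2.2.1.choose_spec.2
  c := pullback.cone t s
  isLimit := pullback.isLimit t s
  t := h.2.2.2.choose
  transitivity₁ := h.2.2.2.choose_spec.1
  transitivity₂ := h.2.2.2.choose_spec.2

/-- A left exact functor preserves internal equivalence relations. -/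
noncomputable def mapEquivalenceRelation (h : IsInternalEquivRel s t) {E : Type*} [Category* E]
    (G : C ⥤ E) [PreservesFiniteLimits G] : EquivalenceRelation (G.map s) (G.map t) :=
  have := h.jointlyMono₂_map G
  { h.equivalenceRelation.toReflexiveRelation.map G,
    h.equivalenceRelation.toSymmetricRelation.map G,
    h.equivalenceRelation.toTransitiveRelation.map G with }

end IsInternalEquivRel

/-- A kernel pair is an internal equivalence relation. -/
lemma CategoryTheory.IsKernelPair.isInternalEquivRel {C : Type*} [Category* C] [HasFiniteLimits C]
    {R X Y : C} {s t : R ⟶ X} {f : X ⟶ Y} (h : IsKernelPair f s t) : IsInternalEquivRel s t := by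
  have w : (pullback.fst t s ≫ s) ≫ f = (pullback.snd t s ≫ t) ≫ f := by
    rw [Category.assoc, h.w, pullback.condition_assoc, Category.assoc, h.w]
  refine ⟨⟨fun a b hab ↦ h.hom_ext ?_ ?_⟩, ⟨h.lift (𝟙 X) (𝟙 X) rfl, by simp⟩,
    ⟨h.lift t s h.w.symm, by simp⟩,
    ⟨h.lift _ _ w, h.lift_fst _ _ w, h.lift_snd _ _ w⟩⟩
  · simpa only [Category.assoc, prod.lift_fst] using hab =≫ prod.fst
  · simpa only [Category.assoc, prod.lift_snd] using hab =≫ prod.snd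

/-- Equivalence relations are effective in the category of types. -/
lemma TypeCat.isKernelPair_of_isColimit {R X Q : Type v} {p₁ p₂ : R ⟶ X}
    (e : EquivalenceRelation p₁ p₂) {q : X ⟶ Q} {w : p₁ ≫ q = p₂ ≫ q}
    (hq : IsColimit (Cofork.ofπ q w)) : IsKernelPair q p₁ p₂ := by
  let S : Setoid X := ⟨_, equivalence_of_equivalenceRelation e⟩
  let k : X ⟶ Quotient S := ↾(Quotient.mk S)
  have hk : p₁ ≫ k = p₂ ≫ k := by
    ext r
    exact Quotient.sound (s := S) ⟨r, rfl, rfl⟩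
  have hker : IsKernelPair k p₁ p₂ := by
    refine (Types.isPullback_iff _ _ _ _).2 ⟨hk, fun x y hxy ↦ ?_, fun x y hxy ↦ ?_⟩
    · have h := e.right_cancellation (↾(fun _ : PUnit.{v + 1} ↦ x)) (↾(fun _ ↦ y))
        (by ext; exact hxy.1) (by ext; exact hxy.2)
      exact ConcreteCategory.congr_hom h PUnit.unit
    · exact Quotient.exact (s := S) hxy
  obtain ⟨d, hd⟩ := Cofork.IsColimit.desc' hq k hk
  replace hd : q ≫ d = k := hd
  exact IsKernelPair.cancel_right w (hd ▸ hker)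

namespace CategoryTheory.Sheaf

variable {D : Type v} [SmallCategory D] {J : GrothendieckTopology D}

/-- Coequalizers of sheaves of types are effective for pairs which are sectionwise equivalence
relations. -/
lemma isKernelPair_of_isColimit {R X Q : Sheaf J (Type v)} {s t : R ⟶ X}
    (e : ∀ U, EquivalenceRelation (s.hom.app U) (t.hom.app U)) {π : X ⟶ Q} {w : s ≫ π = t ≫ π}
    (hπ : IsColimit (Cofork.ofπ π w)) : IsKernelPair π s t := by
  let L := presheafToSheaf J (Type v)
  let ε := (sheafificationAdjunction J (Type v)).counit
  let q := coequalizer.π s.hom t.hom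
  have hq : IsKernelPair q s.hom t.hom := .of_forall_isPullback_app fun U ↦
    TypeCat.isKernelPair_of_isColimit (e U)
      (isColimitCoforkMapOfIsColimit ((evaluation _ _).obj U) _
        (coequalizerIsCoequalizer s.hom t.hom))
  let k : X ⟶ L.obj (coequalizer s.hom t.hom) := inv (ε.app X) ≫ L.map q
  have hk : IsKernelPair k s t :=
    (hq.map L).of_iso (asIso (ε.app R)) (asIso (ε.app X)) (asIso (ε.app X)) (Iso.refl _)
      (ε.naturality s) (ε.naturality t) (by simp [k]) (by simp [k])
  obtain ⟨d, hd⟩ := Cofork.IsColimit.desc' hπ k hk.w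
  replace hd : π ≫ d = k := hd
  exact IsKernelPair.cancel_right w (hd ▸ hk)

/-- Epimorphisms of sheaves of types are stable under base change. -/
lemma epi_of_isPullback_s5 {P Y Z X : Sheaf J (Type v)} {a : P ⟶ Y} {b : P ⟶ Z} {f : Y ⟶ X}
    {g : Z ⟶ X} (h : IsPullback a b f g) [Epi f] : Epi b := by
  have hf := (isLocallySurjective_iff_epi f).2 inferInstance
  refine (isLocallySurjective_iff_epi b).1 ⟨fun {U} z ↦ ?_⟩
  refine J.superset_covering ?_ (Presheaf.imageSieve_mem J f.hom (g.hom.app _ z))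
  rintro V i ⟨y, hy⟩
  obtain ⟨x, -, hx⟩ := Types.exists_of_isPullback
    ((h.map (sheafToPresheaf J _)).app (Opposite.op V)) y (Z.obj.map i.op z)
    (hy.trans (NatTrans.naturality_apply g.hom i.op z).symm)
  exact ⟨x, hx⟩

end CategoryTheory.Sheaf

/-- Let `C` be a finitely complete category in which every internal
equivalence relation has a coequalizer.  If there is a small site `(D, J)` and a fully
faithful functor `F : C ⥤ Sh(D, J)` preserving finite limits and coequalizers of internal
equivalence relations, then `C` is Barr-exact: regular epimorphisms are stable under
pullback and every internal equivalence relation is the kernel pair of its coequalizer. -/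
theorem stmt5 {C : Type u} [Category.{v} C] [HasFiniteLimits C]
    (hcoeq : ∀ {R X : C} (s t : R ⟶ X), IsInternalEquivRel s t → HasCoequalizer s t)
    (D : Type v) [SmallCategory D] (J : GrothendieckTopology D)
    (F : C ⥤ Sheaf J (Type v)) (hfull : F.Full) (hfaithful : F.Faithful)
    (hlex : PreservesFiniteLimits F)
    (hpres : ∀ {R X : C} (s t : R ⟶ X), IsInternalEquivRel s t →
      PreservesColimit (parallelPair s t) F) :
    (∀ {X Y Z : C} (f : Y ⟶ X) (g : Z ⟶ X),
      Nonempty (RegularEpi f) → Nonempty (RegularEpi (pullback.snd f g))) ∧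
    (∀ {R X Q : C} (s t : R ⟶ X), IsInternalEquivRel s t →
      ∀ (π : X ⟶ Q) (w : s ≫ π = t ≫ π), IsColimit (Cofork.ofπ π w) →
        IsKernelPair π s t) := by
  refine ⟨fun {X Y Z} f g ⟨hf⟩ ↦ ?_, fun {R X Q} s t hst π w hπ ↦ ?_⟩
  · have hker := IsKernelPair.of_hasPullback f
    have := hpres _ _ hker.isInternalEquivRel
    have : Epi (F.map f) :=
      epi_of_isColimit_cofork (isColimitCoforkMapOfIsColimit F _ (hker.toCoequalizer hf))
    have : Epi (F.map (pullback.snd f g)) :=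
      Sheaf.epi_of_isPullback_s5 ((IsPullback.of_hasPullback f g).map F)
    have hker' := (IsKernelPair.of_hasPullback (pullback.snd f g)).map F
    exact ⟨regularEpiOfKernelPair _ (isColimitOfIsColimitCoforkMap F _
      (IsKernelPair.toCoequalizer hker' (regularEpiOfEpi _)))⟩
  · have := hpres s t hst
    refine IsPullback.of_map F w (Sheaf.isKernelPair_of_isColimit (fun U ↦ ?_)
      (isColimitCoforkMapOfIsColimit F w hπ))
    exact hst.mapEquivalenceRelation (F ⋙ sheafToPresheaf J (Type v) ⋙ (evaluation _ _).obj U)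
end

section
/- Let κ be a regular cardinal and let 𝒞 be a small category with finite limits and with colimits of all κ-small filtered diagrams, in which finite limits commute with κ-small filtered colimits. Then the Grothendieck topology J on 𝒞 generated by declaring, for every colimit cocone of a κ-small filtered diagram, the sieve generated by the cocone's injections to be covering, is subcanonical (every representable presheaf is a J-sheaf), and the induced functor 𝒞 → Sh(𝒞, J) obtained by restricting the Yoneda embedding is fully faithful, preserves finite limits, and preserves colimits of κ-small filtered diagrams. -/
open CategoryTheory CategoryTheory.Limits

universe v

/-- The Grothendieck topology on `C` generated by declaring, for every colimit cocone of a
`κ`-small filtered diagram, the sieve generated by the cocone's injections to be covering: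
it is the smallest Grothendieck topology containing all such sieves. -/
def filteredColimitTopology (C : Type v) [SmallCategory C] (κ : Cardinal.{v}) :
    GrothendieckTopology C :=
  sInf { K : GrothendieckTopology C |
    ∀ (J : Type v) [SmallCategory J], IsFiltered J → Cardinal.mk (Arrow J) < κ →
      ∀ (D : J ⥤ C) (c : Cocone D), Nonempty (IsColimit c) →
        Sieve.generate (Presieve.ofArrows D.obj c.ι.app) ∈ K c.pt }

theorem filteredColimitTopology_generate_mem {C : Type v} [SmallCategory C] {κ : Cardinal.{v}}
    {J : Type v} [SmallCategory J] [IsFiltered J] (hJ : Cardinal.mk (Arrow J) < κ)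
    {D : J ⥤ C} {c : Cocone D} (hc : IsColimit c) :
    Sieve.generate (Presieve.ofArrows D.obj c.ι.app) ∈ filteredColimitTopology C κ c.pt :=
  (GrothendieckTopology.mem_sInf _ _).2 fun _ hK ↦ hK J inferInstance hJ D c ⟨hc⟩

theorem mk_arrow_under_lt {κ : Cardinal.{v}} (hκ : κ.IsRegular) {J : Type v} [SmallCategory J]
    (hJ : Cardinal.mk (Arrow J) < κ) (j : J) : Cardinal.mk (Arrow (Under j)) < κ := by
  let φ : Arrow (Under j) → Arrow J × Arrow J :=
    fun f ↦ (Arrow.mk f.left.hom, Arrow.mk f.hom.right)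
  have hφ : Function.Injective φ := by
    rintro ⟨⟨⟨⟨⟩⟩, X, x⟩, ⟨⟨⟨⟩⟩, Y, y⟩, ⟨⟨⟨u⟩⟩, f, hf⟩⟩
      ⟨⟨⟨⟨⟩⟩, X', x'⟩, ⟨⟨⟨⟩⟩, Y', y'⟩, ⟨⟨⟨u'⟩⟩, f', hf'⟩⟩ h
    simp only [φ, Prod.mk.injEq] at h
    obtain ⟨h₁, h₂⟩ := h
    dsimp [Arrow.mk] at h₁ h₂
    cases h₁
    cases h₂
    have hy : y = x ≫ f := by simpa using hf
    have hy' : y' = x ≫ f := by simpa using hf'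
    obtain rfl := hy.trans hy'.symm
    rfl
  refine (Cardinal.mk_le_of_injective hφ).trans_lt ?_
  simpa using Cardinal.mul_lt_of_lt hκ.aleph0_le hJ hJ

section

variable {C : Type v} [SmallCategory C] {J : Type v} [SmallCategory J]

/-- Representable presheaves are sheaves for the sieve generated by a colimit cocone. -/
theorem isSheafFor_yoneda_generate_of_isColimit {D : J ⥤ C} {c : Cocone D} (hc : IsColimit c)
    (X : C) :
    (Sieve.generate (Presieve.ofArrows D.obj c.ι.app)).arrows.IsSheafFor (yoneda.obj X) := by
  rw [← Presieve.isSheafFor_iff_generate, Presieve.isSheafFor_arrows_iff]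
  intro x hx
  let s : Cocone D := Cocone.mk X
    { app := x
      naturality := fun i j f ↦ by
        simpa using (hx i j (D.obj i) (𝟙 _) (D.map f) (by simp)).symm }
  exact ⟨hc.desc s, fun i ↦ hc.fac s i, fun y hy ↦ hc.uniq s y hy⟩

variable [IsConnected J] [HasColimitsOfShape J C] [HasFiniteLimits C]
  [PreservesFiniteLimits (colim (J := J) (C := C))]

/-- If `J`-shaped colimits commute with finite limits, they are stable under base change. -/
theorem nonempty_isColimit_pullback {D : J ⥤ C} {c : Cocone D} (hc : IsColimit c) {Y : C}
    (f : Y ⟶ c.pt) :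
    Nonempty (IsColimit (Cocone.mk Y (pullback.fst ((Functor.const J).map f) c.ι))) := by
  rw [Cocone.isColimit_iff_isIso_colimMap_ι]
  have h := (IsPullback.of_hasPullback ((Functor.const J).map f) c.ι).map
    (colim (J := J) (C := C))
  have : IsIso (colim.map c.ι) := hc.isIso_colimMap_ι
  exact h.isIso_fst_of_isIso

/-- If `J`-shaped colimits commute with finite limits, then an object on which two maps to the
diagram agree in the colimit is the colimit of the equalizers of these maps. -/
theorem nonempty_isColimit_equalizer {D : J ⥤ C} {c : Cocone D} (hc : IsColimit c) {W : C}
    (a b : (Functor.const J).obj W ⟶ D) (h : a ≫ c.ι = b ≫ c.ι) :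
    Nonempty (IsColimit (Cocone.mk W (equalizer.ι a b))) := by
  rw [Cocone.isColimit_iff_isIso_colimMap_ι]
  have : IsIso (colim.map c.ι) := hc.isIso_colimMap_ι
  have hab : colim.map a = colim.map b := by
    rw [← cancel_mono (colim.map c.ι), ← Functor.map_comp, h, Functor.map_comp]
  exact isIso_limit_cone_parallelPair_of_eq hab
    (isLimitForkMapOfIsLimit colim _ (equalizerIsEqualizer a b))

theorem generate_mem_canonicalTopology {D : J ⥤ C} {c : Cocone D} (hc : IsColimit c) :
    Sieve.generate (Presieve.ofArrows D.obj c.ι.app) ∈ Sheaf.canonicalTopology C c.pt := by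
  refine Sheaf.mem_finestTopology_of_forall_isSheafFor ?_
  rintro _ ⟨X, rfl⟩ Y f
  have := Sieve.ofArrows_eq_pullback_of_isPullback (fun j ↦ c.ι.app j) (g := f)
    (fun j ↦ (IsPullback.of_hasPullback ((Functor.const J).map f) c.ι).map
      ((evaluation J C).obj j))
  erw [← this]
  exact isSheafFor_yoneda_generate_of_isColimit (nonempty_isColimit_pullback hc f).some X

end

section

variable {κ : Cardinal.{v}} {C : Type v} [SmallCategory C] [HasFiniteLimits C]

theorem isSheaf_filteredColimitTopology_yoneda
    (hcolim : ∀ (J : Type v) [SmallCategory J], IsFiltered J → Cardinal.mk (Arrow J) < κ →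
      HasColimitsOfShape J C)
    (hcomm : ∀ (J : Type v) [SmallCategory J]
      (h1 : IsFiltered J) (h2 : Cardinal.mk (Arrow J) < κ),
      letI := hcolim J h1 h2
      PreservesFiniteLimits (colim (J := J) (C := C))) (X : C) :
    Presieve.IsSheaf (filteredColimitTopology C κ) (yoneda.obj X) := by
  refine Presieve.isSheaf_of_le _ ?_ (Sheaf.isSheaf_yoneda_obj X)
  refine sInf_le ?_
  rintro J _ h₁ h₂ D c ⟨hc⟩
  have := hcolim J h₁ h₂
  have := hcomm J h₁ h₂
  have := IsFiltered.isConnected J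
  exact generate_mem_canonicalTopology hc

/-- A family of sections of a sheaf over a `κ`-small filtered diagram which is compatible with the
transition maps is compatible on the colimit cocone. -/
theorem arrowsCompatible_of_isColimit (hκ : κ.IsRegular)
    (hcolim : ∀ (J : Type v) [SmallCategory J], IsFiltered J → Cardinal.mk (Arrow J) < κ →
      HasColimitsOfShape J C)
    (hcomm : ∀ (J : Type v) [SmallCategory J]
      (h1 : IsFiltered J) (h2 : Cardinal.mk (Arrow J) < κ),
      letI := hcolim J h1 h2
      PreservesFiniteLimits (colim (J := J) (C := C)))
    {P : Cᵒᵖ ⥤ Type v} (hP : Presieve.IsSheaf (filteredColimitTopology C κ) P)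
    {J : Type v} [SmallCategory J] [IsFiltered J] (hJ : Cardinal.mk (Arrow J) < κ)
    {D : J ⥤ C} {c : Cocone D} (hc : IsColimit c) (x : ∀ j, P.obj (.op (D.obj j)))
    (hx : ∀ ⦃i j : J⦄ (f : i ⟶ j), P.map (D.map f).op (x j) = x i) :
    Presieve.Arrows.Compatible P c.ι.app x := by
  intro i j W g h hgh
  let l := IsFiltered.max i j
  let a : W ⟶ D.obj l := g ≫ D.map (IsFiltered.leftToMax i j)
  let b : W ⟶ D.obj l := h ≫ D.map (IsFiltered.rightToMax i j)
  suffices P.map a.op (x l) = P.map b.op (x l) by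
    simpa [a, b, l, hx] using this
  have hl := mk_arrow_under_lt hκ hJ l
  have := hcolim (Under l) inferInstance hl
  have := hcomm (Under l) inferInstance hl
  have := IsFiltered.isConnected (Under l)
  let τ (u : W ⟶ D.obj l) : (Functor.const (Under l)).obj W ⟶ Under.forget l ⋙ D :=
    { app m := u ≫ D.map m.hom
      naturality m n f := by simp [← Functor.map_comp] }
  have hc' : IsColimit (c.whisker (Under.forget l)) :=
    (Functor.Final.isColimitWhiskerEquiv (Under.forget l) c).symm hc
  obtain ⟨he⟩ := nonempty_isColimit_equalizer hc' (τ a) (τ b) (by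
    ext m
    simpa [τ, a, b] using hgh)
  refine (hP _ (filteredColimitTopology_generate_mem hl he)).isSeparatedFor.ext ?_
  rintro Z _ ⟨_, k, _, ⟨m⟩, rfl⟩
  have key := congr_arg (fun q ↦ P.map (k ≫ q).op (x m.right))
    (NatTrans.congr_app (equalizer.condition (τ a) (τ b)) m)
  rw [← show P.map (D.map m.hom).op (x m.right) = x l from hx m.hom]
  simp only [← comp_apply, ← P.map_comp, ← op_comp, Category.assoc]
  exact key

theorem preservesColimitsOfShape_yoneda (hκ : κ.IsRegular)
    (hcolim : ∀ (J : Type v) [SmallCategory J], IsFiltered J → Cardinal.mk (Arrow J) < κ →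
      HasColimitsOfShape J C)
    (hcomm : ∀ (J : Type v) [SmallCategory J]
      (h1 : IsFiltered J) (h2 : Cardinal.mk (Arrow J) < κ),
      letI := hcolim J h1 h2
      PreservesFiniteLimits (colim (J := J) (C := C)))
    [(filteredColimitTopology C κ).Subcanonical]
    (J : Type v) [SmallCategory J] [IsFiltered J] (hJ : Cardinal.mk (Arrow J) < κ) :
    PreservesColimitsOfShape J (filteredColimitTopology C κ).yoneda := by
  let T := filteredColimitTopology C κ
  refine ⟨fun {D} ↦ ⟨fun {c} hc ↦ ?_⟩⟩
  have key (s : Cocone (D ⋙ T.yoneda)) :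
      ∃! t : T.yoneda.obj c.pt ⟶ s.pt, ∀ j, T.yoneda.map (c.ι.app j) ≫ t = s.ι.app j := by
    have hP : Presieve.IsSheaf T s.pt.obj := (isSheaf_iff_isSheaf_of_type _ _).1 s.pt.property
    have hS := hP _ (filteredColimitTopology_generate_mem hJ hc)
    rw [← Presieve.isSheafFor_iff_generate, Presieve.isSheafFor_arrows_iff] at hS
    obtain ⟨t, ht, ht'⟩ := hS _ (arrowsCompatible_of_isColimit hκ hcolim hcomm hP hJ hc
      (fun j ↦ T.yonedaEquiv (s.ι.app j)) (fun i j f ↦ by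
        rw [T.yonedaEquiv_naturality]
        exact congr_arg _ (s.w f)))
    refine ⟨T.yonedaEquiv.symm t, fun j ↦ ?_, fun u hu ↦ ?_⟩
    · rw [T.yonedaEquiv_symm_naturality_left]
      erw [ht j]
      exact T.yonedaEquiv.symm_apply_apply _
    · rw [Equiv.eq_symm_apply]
      refine ht' _ fun j ↦ ?_
      rw [← hu j]
      exact T.yonedaEquiv_naturality _ _
  exact ⟨IsColimit.ofExistsUnique key⟩

end

/-- Let `κ` be a regular cardinal and `C` a small finitely complete category
with colimits of `κ`-small filtered diagrams in which finite limits commute with `κ`-small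
filtered colimits.  Then the topology generated by the sieves of injections of colimit
cocones of `κ`-small filtered diagrams is subcanonical, and the induced functor
`C ⥤ Sh(C, J)` restricting the Yoneda embedding is fully faithful, preserves finite limits,
and preserves colimits of `κ`-small filtered diagrams. -/
theorem stmt6 (κ : Cardinal.{v}) (hκ : κ.IsRegular)
    (C : Type v) [SmallCategory C] [HasFiniteLimits C]
    (hcolim : ∀ (J : Type v) [SmallCategory J], IsFiltered J → Cardinal.mk (Arrow J) < κ →
      HasColimitsOfShape J C)
    (hcomm : ∀ (J : Type v) [SmallCategory J]
      (h1 : IsFiltered J) (h2 : Cardinal.mk (Arrow J) < κ),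
      letI := hcolim J h1 h2
      PreservesFiniteLimits (colim (J := J) (C := C))) :
    (∀ X : C, Presieve.IsSheaf (filteredColimitTopology C κ) (yoneda.obj X)) ∧
    ∀ (F : C ⥤ Sheaf (filteredColimitTopology C κ) (Type v)),
      (F ⋙ sheafToPresheaf _ _ ≅ yoneda) →
        F.Full ∧ F.Faithful ∧ PreservesFiniteLimits F ∧
        ∀ (J : Type v) [SmallCategory J], IsFiltered J → Cardinal.mk (Arrow J) < κ →
          PreservesColimitsOfShape J F := by
  have hs := isSheaf_filteredColimitTopology_yoneda hcolim hcomm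
  refine ⟨hs, fun F e ↦ ?_⟩
  have := GrothendieckTopology.Subcanonical.of_isSheaf_yoneda_obj _ hs
  let i : (filteredColimitTopology C κ).yoneda ≅ F :=
    Functor.fullyFaithfulCancelRight (sheafToPresheaf _ _) e.symm
  have : PreservesFiniteLimits (F ⋙ sheafToPresheaf (filteredColimitTopology C κ) (Type v)) :=
    ⟨fun _ _ _ ↦ preservesLimitsOfShape_of_natIso e.symm⟩
  refine ⟨.of_iso i, .of_iso i,
    preservesFiniteLimits_of_reflects_of_preserves F (sheafToPresheaf _ _), fun J _ _ hJ ↦ ?_⟩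
  have := preservesColimitsOfShape_yoneda hκ hcolim hcomm J hJ
  exact preservesColimitsOfShape_of_natIso i
end

section
/- Let 𝒞 be a small category and let f : φ ⟶ ψ be a morphism in the presheaf category [𝒞ᵒᵖ, Set]. Then f is stably final if and only if for every object D of 𝒞 and every morphism g : y(D) ⟶ ψ from the representable presheaf y(D), the pullback of f along g is final. -/
open CategoryTheory CategoryTheory.Limits

universe u

/-- A morphism of presheaves is *final* if it is orthogonal to every representable presheaf:
every morphism from its domain to a representable extends uniquely along it. -/
def IsFinalMor {C : Type u} [SmallCategory C] {φ ψ : Cᵒᵖ ⥤ Type u} (f : φ ⟶ ψ) : Prop :=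
  ∀ (E : C) (g : φ ⟶ yoneda.obj E), ∃! h : ψ ⟶ yoneda.obj E, f ≫ h = g

/-- A morphism of presheaves is *stably final* if every pullback of it (along an arbitrary
morphism into its codomain) is final. -/
def IsStablyFinalMor {C : Type u} [SmallCategory C] {φ ψ : Cᵒᵖ ⥤ Type u} (f : φ ⟶ ψ) : Prop :=
  ∀ {χ : Cᵒᵖ ⥤ Type u} (g : χ ⟶ ψ), IsFinalMor (pullback.snd f g)

/-- A family of maps out of the generalized elements of a presheaf `χ` at representables,
compatible with restriction, is induced by a unique morphism out of `χ`. -/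
theorem exists_hom_of_yoneda_family {C : Type u} [SmallCategory C] {χ ω : Cᵒᵖ ⥤ Type u}
    (T : ∀ {D : C}, (yoneda.obj D ⟶ χ) → (yoneda.obj D ⟶ ω))
    (hT : ∀ {D D' : C} (v : D' ⟶ D) (a : yoneda.obj D ⟶ χ),
      T (yoneda.map v ≫ a) = yoneda.map v ≫ T a) :
    ∃ h : χ ⟶ ω, ∀ {D : C} (a : yoneda.obj D ⟶ χ), a ≫ h = T a := by
  refine ⟨{ app := fun X => TypeCat.ofHom fun x => yonedaEquiv (T (yonedaEquiv.symm x))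
            naturality := ?_ }, ?_⟩
  · intro X Y v
    ext x
    have h := hT v.unop (yonedaEquiv.symm x)
    rw [← yonedaEquiv_symm_map] at h
    exact (congrArg yonedaEquiv h).trans (yonedaEquiv_naturality' _ v).symm
  · intro D a
    apply yonedaEquiv.injective
    rw [yonedaEquiv_comp]
    simp

/-- A morphism of presheaves on a small category is stably final if and
only if every pullback of it along a morphism with representable domain is final. -/
theorem stmt11 {C : Type u} [SmallCategory C] {φ ψ : Cᵒᵖ ⥤ Type u} (f : φ ⟶ ψ) :
    IsStablyFinalMor f ↔
      ∀ (D : C) (g : yoneda.obj D ⟶ ψ), IsFinalMor (pullback.snd f g) := by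
  refine ⟨fun H D g => H g, fun H χ k E g => ?_⟩
  let c {D : C} (a : yoneda.obj D ⟶ χ) : pullback f (a ≫ k) ⟶ pullback f k :=
    pullback.lift (pullback.fst f (a ≫ k)) (pullback.snd f (a ≫ k) ≫ a)
      (by simp [pullback.condition])
  have hc_fst {D : C} (a : yoneda.obj D ⟶ χ) :
      c a ≫ pullback.fst f k = pullback.fst f (a ≫ k) := pullback.lift_fst _ _ _
  have hc_snd {D : C} (a : yoneda.obj D ⟶ χ) :
      c a ≫ pullback.snd f k = pullback.snd f (a ≫ k) ≫ a := pullback.lift_snd _ _ _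
  choose T hT hT_unique using
    fun (D : C) (a : yoneda.obj D ⟶ χ) => H D (a ≫ k) E (c a ≫ g)
  obtain ⟨h, hh⟩ := exists_hom_of_yoneda_family (fun {D} a => T D a) (fun {D D'} v a => by
    refine (hT_unique D' (yoneda.map v ≫ a) _ ?_).symm
    let m : pullback f ((yoneda.map v ≫ a) ≫ k) ⟶ pullback f (a ≫ k) :=
      pullback.lift (pullback.fst _ _) (pullback.snd _ _ ≫ yoneda.map v)
        (by simp [pullback.condition])
    have hm_fst : m ≫ pullback.fst f (a ≫ k) = pullback.fst _ _ := pullback.lift_fst _ _ _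
    have hm_snd : m ≫ pullback.snd f (a ≫ k) = pullback.snd _ _ ≫ yoneda.map v :=
      pullback.lift_snd _ _ _
    have hm : m ≫ c a = c (yoneda.map v ≫ a) := by
      apply pullback.hom_ext
      · rw [Category.assoc m, hc_fst, hm_fst, hc_fst]
      · rw [Category.assoc m, hc_snd, ← Category.assoc m, hm_snd, hc_snd,
          Category.assoc (pullback.snd _ _)]
    change pullback.snd f ((yoneda.map v ≫ a) ≫ k) ≫ yoneda.map v ≫ T D a =
      c (yoneda.map v ≫ a) ≫ g
    rw [← hm, Category.assoc m, ← hT D a, ← Category.assoc m, hm_snd,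
      Category.assoc (pullback.snd _ _)])
  refine ⟨h, hom_ext_yoneda fun D p => ?_, fun h' hh' => hom_ext_yoneda fun D a => ?_⟩
  · let a := p ≫ pullback.snd f k
    let l : yoneda.obj D ⟶ pullback f (a ≫ k) :=
      pullback.lift (p ≫ pullback.fst f k) (𝟙 _) (by simp [a, pullback.condition])
    have hl_fst : l ≫ pullback.fst f (a ≫ k) = p ≫ pullback.fst f k := pullback.lift_fst _ _ _
    have hl_snd : l ≫ pullback.snd f (a ≫ k) = 𝟙 _ := pullback.lift_snd _ _ _
    have hl : l ≫ c a = p := by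
      apply pullback.hom_ext
      · rw [Category.assoc, hc_fst, hl_fst]
      · rw [Category.assoc, hc_snd, ← Category.assoc, hl_snd, Category.id_comp]
    calc p ≫ pullback.snd f k ≫ h = T D a := by rw [← Category.assoc]; exact hh a
      _ = l ≫ pullback.snd f (a ≫ k) ≫ T D a := by rw [← Category.assoc, hl_snd, Category.id_comp]
      _ = p ≫ g := by rw [hT D a, ← Category.assoc, hl]
  · rw [hh a]
    refine hT_unique D a _ ?_
    change pullback.snd f (a ≫ k) ≫ a ≫ h' = c a ≫ g
    rw [← hh', ← Category.assoc, ← Category.assoc, hc_snd]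
end

section
/- Let 𝒟 be a small finitely complete category and let ℰ be a category admitting a fully faithful functor ℰ → [𝒟ᵒᵖ, Set] with a left exact (finite-limit-preserving) left adjoint. Then for every small finitely complete category 𝒦 and every finite-limit-preserving functor D : 𝒦 → ℰ, the pointwise left Kan extension of D along the Yoneda embedding 𝒦 → [𝒦ᵒᵖ, Set] exists and preserves finite limits. -/
open CategoryTheory CategoryTheory.Limits

universe v u

/-- A functor on presheaves which preserves small colimits is the pointwise left Kan extension
along the Yoneda embedding of its restriction to representables. -/
noncomputable def isPointwiseLeftKanExtensionOfPreservesColimits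
    {K : Type v} [SmallCategory K] {E : Type u} [Category.{v} E] {F : K ⥤ E}
    {T : (Kᵒᵖ ⥤ Type v) ⥤ E} [PreservesColimitsOfSize.{v, v} T] (e : F ≅ yoneda ⋙ T) :
    (Functor.LeftExtension.mk T e.hom).IsPointwiseLeftKanExtension := fun P =>
  (IsColimit.precomposeHomEquiv
    (Functor.isoWhiskerLeft (CostructuredArrow.proj yoneda P) e) _).symm
      (isColimitOfPreserves T (Presheaf.isColimitTautologicalCocone P)) |>.ofIsoColimit
    (Cocone.ext (Iso.refl _) fun _ => Category.comp_id _)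

/-- The tensor product with a functor `A : K ⥤ Type v`, computed as a colimit over the
category of elements of `A`. -/
noncomputable def elementsTensor {K : Type v} [SmallCategory K] (A : K ⥤ Type v) :
    (Kᵒᵖ ⥤ Type v) ⥤ Type v :=
  (Functor.whiskeringLeft _ _ _).obj (CategoryOfElements.π A).op ⋙ colim

instance {K : Type v} [SmallCategory K] (A : K ⥤ Type v) :
    PreservesColimitsOfSize.{v, v} (elementsTensor A) where
  preservesColimitsOfShape := by
    dsimp [elementsTensor]
    infer_instance

lemma preservesFiniteLimits_elementsTensor {K : Type v} [SmallCategory K] [HasFiniteLimits K]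
    (A : K ⥤ Type v) [PreservesFiniteLimits A] : PreservesFiniteLimits (elementsTensor A) := by
  have := A.isCofiltered_elements
  exact comp_preservesFiniteLimits _ _

/-- Tensoring a representable presheaf with `A` gives the value of `A`. -/
noncomputable def yonedaCompElementsTensor {K : Type v} [SmallCategory K] (A : K ⥤ Type v) :
    A ≅ yoneda ⋙ elementsTensor A :=
  (Functor.Elements.shrinkYonedaCompWhiskeringLeftObjπCompColimIso A).symm ≪≫
    Functor.isoWhiskerRight shrinkYonedaIsoYoneda (elementsTensor A)

/-- The pointwise left Kan extension along the Yoneda embedding of a set-valued functor `A` is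
the tensor product with `A`. -/
noncomputable def isoElementsTensor {K : Type v} [SmallCategory K] {A : K ⥤ Type v}
    {T : (Kᵒᵖ ⥤ Type v) ⥤ Type v} {α : A ⟶ yoneda ⋙ T}
    (h : (Functor.LeftExtension.mk T α).IsPointwiseLeftKanExtension) :
    T ≅ elementsTensor A :=
  have : T.IsLeftKanExtension α := h.isLeftKanExtension
  have : (elementsTensor A).IsLeftKanExtension (yonedaCompElementsTensor A).hom :=
    (isPointwiseLeftKanExtensionOfPreservesColimits (yonedaCompElementsTensor A)).isLeftKanExtension
  Functor.leftKanExtensionUnique T α _ (yonedaCompElementsTensor A).hom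

section

variable {K D : Type v} [SmallCategory K] [SmallCategory D] (H : K ⥤ Dᵒᵖ ⥤ Type v)

/-- The evaluation at `d` of the Yoneda extension of `H` is the tensor product with `H(-)(d)`. -/
noncomputable def pointwiseLeftKanExtensionCompEvaluationIso (d : Dᵒᵖ) :
    yoneda.pointwiseLeftKanExtension H ⋙ (evaluation _ _).obj d ≅
      elementsTensor (H ⋙ (evaluation _ _).obj d) :=
  isoElementsTensor
    ((yoneda.pointwiseLeftKanExtensionIsPointwiseLeftKanExtension H).postcompose
      ((evaluation _ _).obj d))

instance preservesColimits_yonedaExtension :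
    PreservesColimitsOfSize.{v, v} (yoneda.pointwiseLeftKanExtension H) where
  preservesColimitsOfShape := preservesColimitsOfShape_of_evaluation _ _ fun d =>
    preservesColimitsOfShape_of_natIso (pointwiseLeftKanExtensionCompEvaluationIso H d).symm

lemma preservesFiniteLimits_yonedaExtension [HasFiniteLimits K] [PreservesFiniteLimits H] :
    PreservesFiniteLimits (yoneda.pointwiseLeftKanExtension H) where
  preservesFiniteLimits J _ _ := preservesLimitsOfShape_of_evaluation _ _ fun d => by
    have : PreservesFiniteLimits (H ⋙ (evaluation _ _).obj d) := comp_preservesFiniteLimits _ _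
    have := preservesFiniteLimits_elementsTensor (H ⋙ (evaluation _ _).obj d)
    exact preservesLimitsOfShape_of_natIso (pointwiseLeftKanExtensionCompEvaluationIso H d).symm

end

/-- Let `D` be a small finitely complete category and let `E` be a
category admitting a fully faithful functor `G : E ⥤ [Dᵒᵖ, Set]` with a finite-limit-
preserving left adjoint.  Then for every small finitely complete category `K` and every
finite-limit-preserving functor `F : K ⥤ E`, the pointwise left Kan extension of `F` along
the Yoneda embedding `K ⥤ [Kᵒᵖ, Set]` exists and preserves finite limits. -/
theorem stmt15 {E : Type u} [Category.{v} E]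
    (D : Type v) [SmallCategory D] [HasFiniteLimits D]
    (G : E ⥤ Dᵒᵖ ⥤ Type v) (hfull : G.Full) (hfaithful : G.Faithful)
    (L : (Dᵒᵖ ⥤ Type v) ⥤ E) (adj : L ⊣ G) (hlex : PreservesFiniteLimits L)
    (K : Type v) [SmallCategory K] [HasFiniteLimits K]
    (F : K ⥤ E) (hF : PreservesFiniteLimits F) :
    ∃ (L' : (Kᵒᵖ ⥤ Type v) ⥤ E) (α : F ⟶ yoneda ⋙ L'),
      Nonempty ((Functor.LeftExtension.mk L' α).IsPointwiseLeftKanExtension) ∧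
      PreservesFiniteLimits L' := by
  have := adj.rightAdjoint_preservesLimits
  have := adj.leftAdjoint_preservesColimits
  have : PreservesFiniteLimits (F ⋙ G) := comp_preservesFiniteLimits F G
  have := preservesFiniteLimits_yonedaExtension (F ⋙ G)
  let T := yoneda.pointwiseLeftKanExtension (F ⋙ G)
  have : IsIso (yoneda.pointwiseLeftKanExtensionUnit (F ⋙ G)) :=
    (yoneda.pointwiseLeftKanExtensionIsPointwiseLeftKanExtension (F ⋙ G)).isIso_hom
  let e : F ≅ yoneda ⋙ T ⋙ L :=
    (Functor.isoWhiskerLeft F (asIso adj.counit)).symm ≪≫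
      Functor.isoWhiskerRight (asIso (yoneda.pointwiseLeftKanExtensionUnit (F ⋙ G))) L
  exact ⟨T ⋙ L, e.hom, ⟨isPointwiseLeftKanExtensionOfPreservesColimits e⟩,
    comp_preservesFiniteLimits T L⟩
end
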